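/- arXiv:2512.11888 — 3 statements merged into one kernel-verified Lean document; each statement's English description precedes it below -/
import Mathlib

section
/- Let n ≥ 1 and 1 ≤ p, q ≤ ∞. There exists a constant C > 0 such that ‖f̂‖_{L^q(ℝ^n)} ≤ C‖f‖_{L^p(ℝ^n)} for every Schwartz function f : ℝ^n → ℂ if and only if 1/p + 1/q = 1 and 1 ≤ p ≤ 2. -/
open MeasureTheory Real Complex RealInnerProductSpace ENNReal

/-- The Fourier transform `f̂(ξ) = ∫ f(x) e^{−2πi x·ξ} dx` of a function on `ℝ^n`. -/
noncomputable def fourierTransformE {n : ℕ} (f : EuclideanSpace ℝ (Fin n) → ℂ)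
    (ξ : EuclideanSpace ℝ (Fin n)) : ℂ :=
  ∫ x : EuclideanSpace ℝ (Fin n), f x * Complex.exp (-2 * Real.pi * Complex.I * (⟪x, ξ⟫ : ℝ))


/-- Polynomial times Gaussian is bounded. -/
lemma hy_poly_gauss_bound (a : ℝ) (ha : 0 < a) (N : ℕ) :
    ∃ C : ℝ, ∀ r : ℝ, 0 ≤ r → (1 + r) ^ N * Real.exp (-a * r ^ 2) ≤ C := by
  refine ⟨N.factorial * Real.exp (1 + 1 / (4 * a)), fun r hr => ?_⟩
  have h1 := Real.pow_div_factorial_le_exp (1 + r) (by linarith) N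
  rw [div_le_iff₀ (by positivity)] at h1
  have h2 : 1 + r + -a * r ^ 2 ≤ 1 + 1 / (4 * a) := by
    have : 1 / (4 * a) - r + a * r ^ 2 = a * (r - 1 / (2 * a)) ^ 2 := by
      field_simp
      ring
    have h3 : 0 ≤ a * (r - 1 / (2 * a)) ^ 2 := by positivity
    linarith
  calc (1 + r) ^ N * Real.exp (-a * r ^ 2)
      ≤ (Real.exp (1 + r) * N.factorial) * Real.exp (-a * r ^ 2) := by gcongr
    _ = N.factorial * Real.exp (1 + r + -a * r ^ 2) := by rw [Real.exp_add (1 + r)]; ring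
    _ ≤ _ := by gcongr

lemma hy_iteratedDeriv_cexp (z : ℂ) (m : ℕ) :
    iteratedDeriv m (fun s : ℝ => Complex.exp (-z * s)) =
      fun s : ℝ => (-z) ^ m * Complex.exp (-z * s) := by
  induction m with
  | zero => simp
  | succ m ih =>
    rw [iteratedDeriv_succ, ih]
    ext s
    have h : HasDerivAt (fun s : ℝ => Complex.exp (-z * s)) (Complex.exp (-z * s) * (-z)) s := by
      have h0 : HasDerivAt (fun s : ℂ => Complex.exp (-z * s))
          (Complex.exp (-z * s) * (-z * 1)) (s : ℂ) :=
        ((hasDerivAt_id (s : ℂ)).const_mul (-z)).cexp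
      simpa using h0.comp_ofReal
    rw [(h.const_mul ((-z) ^ m)).deriv]
    ring

lemma hy_gauss_decay {n : ℕ} (z : ℂ) (hz : 0 < z.re) (k m : ℕ) :
    ∃ C : ℝ, ∀ x : EuclideanSpace ℝ (Fin n),
      ‖x‖ ^ k * ‖iteratedFDeriv ℝ m (fun x : EuclideanSpace ℝ (Fin n) =>
        Complex.exp (-z * ((‖x‖ ^ 2 : ℝ) : ℂ))) x‖ ≤ C := by
  obtain ⟨K, D, hD, hh⟩ := (Function.hasTemperateGrowth_norm_sq
    (EuclideanSpace ℝ (Fin n))).norm_iteratedFDeriv_le_uniform m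
  obtain ⟨C, hC⟩ := hy_poly_gauss_bound z.re hz (k + K * m)
  have hC0 : 0 ≤ C := le_trans (by positivity) (hC 0 le_rfl)
  refine ⟨m.factorial * (1 + ‖z‖) ^ m * (D + 1) ^ m * C, fun x => ?_⟩
  have hg : ContDiff ℝ ((⊤ : ℕ∞) : WithTop ℕ∞) (fun s : ℝ => Complex.exp (-z * s)) := by
    have : ContDiff ℝ ((⊤ : ℕ∞) : WithTop ℕ∞) (fun s : ℝ => (s : ℂ)) := Complex.ofRealCLM.contDiff
    exact (contDiff_const.mul this).cexp
  have hf : ContDiff ℝ ((⊤ : ℕ∞) : WithTop ℕ∞) (fun x : EuclideanSpace ℝ (Fin n) => ‖x‖ ^ 2) := contDiff_norm_sq ℝ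
  have hx : (0:ℝ) ≤ ‖x‖ := norm_nonneg x
  have key := norm_iteratedFDeriv_comp_le hg hf (n := m) (by exact_mod_cast le_top) x
    (C := (1 + ‖z‖) ^ m * Real.exp (-z.re * ‖x‖ ^ 2)) (D := (D + 1) * (1 + ‖x‖) ^ K)
    (by
      intro i hi
      rw [norm_iteratedFDeriv_eq_norm_iteratedDeriv, hy_iteratedDeriv_cexp, norm_mul, norm_pow,
        norm_neg, Complex.norm_exp]
      have e : (-z * ((‖x‖ ^ 2 : ℝ) : ℂ)).re = -z.re * ‖x‖ ^ 2 := by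
        rw [Complex.re_mul_ofReal, Complex.neg_re]
      rw [e]
      gcongr
      calc ‖z‖ ^ i ≤ (1 + ‖z‖) ^ i := by gcongr; linarith
        _ ≤ (1 + ‖z‖) ^ m := by
            apply pow_le_pow_right₀ _ hi
            linarith [norm_nonneg z])
    (by
      intro i hi him
      have h1 : (1:ℝ) ≤ (D + 1) * (1 + ‖x‖) ^ K := by
        have : (1:ℝ) ≤ (1 + ‖x‖) ^ K := one_le_pow₀ (by linarith)
        nlinarith
      refine (hh i him x).trans ?_
      refine le_trans ?_ (le_self_pow₀ h1 (by omega))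
      gcongr
      linarith)
  have key2 : ‖iteratedFDeriv ℝ m (fun x : EuclideanSpace ℝ (Fin n) =>
        Complex.exp (-z * ((‖x‖ ^ 2 : ℝ) : ℂ))) x‖ ≤ _ := key
  calc _ ≤ (1 + ‖x‖) ^ k * (m.factorial * ((1 + ‖z‖) ^ m * Real.exp (-z.re * ‖x‖ ^ 2)) *
          ((D + 1) * (1 + ‖x‖) ^ K) ^ m) := by
        gcongr
        linarith
    _ = m.factorial * (1 + ‖z‖) ^ m * (D + 1) ^ m *
          ((1 + ‖x‖) ^ (k + K * m) * Real.exp (-z.re * ‖x‖ ^ 2)) := by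
        rw [pow_add, pow_mul, mul_pow]; ring
    _ ≤ _ := by
        gcongr
        exact hC _ hx

/-- The complex Gaussian as a Schwartz function. -/
noncomputable def hyGauss (n : ℕ) (z : ℂ) (hz : 0 < z.re) :
    SchwartzMap (EuclideanSpace ℝ (Fin n)) ℂ where
  toFun := fun x => Complex.exp (-z * ((‖x‖ ^ 2 : ℝ) : ℂ))
  smooth' := by
    have h1 : ContDiff ℝ ((⊤ : ℕ∞) : WithTop ℕ∞) (fun x : EuclideanSpace ℝ (Fin n) => ‖x‖ ^ 2) := contDiff_norm_sq ℝ
    have : ContDiff ℝ ((⊤ : ℕ∞) : WithTop ℕ∞) (fun s : ℝ => (s : ℂ)) := Complex.ofRealCLM.contDiff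
    exact (contDiff_const.mul (this.comp h1)).cexp
  decay' := hy_gauss_decay z hz

lemma hyGauss_apply (n : ℕ) (z : ℂ) (hz : 0 < z.re) (x : EuclideanSpace ℝ (Fin n)) :
    hyGauss n z hz x = Complex.exp (-z * ‖x‖ ^ 2) := by
  change Complex.exp (-z * ((‖x‖ ^ 2 : ℝ) : ℂ)) = _
  push_cast
  rfl

lemma hy_fourier_eq {n : ℕ} (f : EuclideanSpace ℝ (Fin n) → ℂ) :
    (fun ξ => ∫ x : EuclideanSpace ℝ (Fin n),
      f x * Complex.exp (-2 * Real.pi * Complex.I * (⟪x, ξ⟫ : ℝ))) = FourierTransform.fourier f := by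
  ext ξ
  rw [Real.fourier_eq']
  congr 1
  ext x
  rw [smul_eq_mul, mul_comm]
  congr 2
  push_cast
  ring

lemma hy_gauss_norm (n : ℕ) (p : ℝ≥0∞) (hp : 1 ≤ p) :
    ∃ c : ℝ, 0 < c ∧ ∀ z : ℂ, 0 < z.re →
      eLpNorm (fun x : EuclideanSpace ℝ (Fin n) => Complex.exp (-z * ‖x‖ ^ 2)) p volume =
        ENNReal.ofReal (c * z.re ^ (-(n / 2 : ℝ) * (p⁻¹).toReal)) := by
  have hnorm : ∀ (z : ℂ) (x : EuclideanSpace ℝ (Fin n)), ‖Complex.exp (-z * ‖x‖ ^ 2)‖ =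
      Real.exp (-z.re * ‖x‖ ^ 2) := by
    intro z x
    rw [Complex.norm_exp]
    congr 1
    rw [← Complex.ofReal_pow, Complex.re_mul_ofReal, Complex.neg_re]
  have hcont : ∀ (z : ℂ), Continuous
      (fun x : EuclideanSpace ℝ (Fin n) => Complex.exp (-z * ‖x‖ ^ 2)) := by
    intro z; fun_prop
  by_cases hpt : p = ∞
  · subst hpt
    refine ⟨1, one_pos, fun z hz => ?_⟩
    simp only [inv_top, toReal_zero, mul_zero, Real.rpow_zero, mul_one, ENNReal.ofReal_one]
    rw [eLpNorm_exponent_top]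
    apply le_antisymm
    · apply eLpNormEssSup_le_of_ae_enorm_bound
      filter_upwards with x
      rw [← ofReal_norm, hnorm, ← ENNReal.ofReal_one]
      apply ENNReal.ofReal_le_ofReal
      rw [Real.exp_le_one_iff]
      have : 0 ≤ z.re * ‖x‖ ^ 2 := by positivity
      linarith
    · have h := enorm_ae_le_eLpNormEssSup
        (fun x : EuclideanSpace ℝ (Fin n) => Complex.exp (-z * ‖x‖ ^ 2)) volume
      have hd := Measure.dense_of_ae h
      have hcl : IsClosed {x : EuclideanSpace ℝ (Fin n) | ‖Complex.exp (-z * ‖x‖ ^ 2)‖ₑ ≤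
          eLpNormEssSup (fun x : EuclideanSpace ℝ (Fin n) => Complex.exp (-z * ‖x‖ ^ 2)) volume} :=
        isClosed_le (hcont z).enorm continuous_const
      have := hcl.closure_eq ▸ hd (0 : EuclideanSpace ℝ (Fin n))
      simpa using this
  · have hP : 0 < p.toReal := ENNReal.toReal_pos (by positivity) hpt
    refine ⟨((π / p.toReal) ^ (n / 2 : ℝ)) ^ (1 / p.toReal), by positivity, fun z hz => ?_⟩
    rw [eLpNorm_eq_lintegral_rpow_enorm_toReal (by positivity) hpt]
    have h1 : ∀ x : EuclideanSpace ℝ (Fin n), ‖Complex.exp (-z * ‖x‖ ^ 2)‖ₑ ^ p.toReal =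
        ENNReal.ofReal (Real.exp (-(p.toReal * z.re) * ‖x‖ ^ 2)) := by
      intro x
      rw [← ofReal_norm, hnorm, ENNReal.ofReal_rpow_of_pos (Real.exp_pos _), ← Real.exp_mul]
      congr 2; ring
    simp_rw [h1]
    have hb : 0 < p.toReal * z.re := by positivity
    have hIntEq := GaussianFourier.integral_rexp_neg_mul_sq_norm
      (V := EuclideanSpace ℝ (Fin n)) hb
    have hI : Integrable (fun x : EuclideanSpace ℝ (Fin n) =>
        Real.exp (-(p.toReal * z.re) * ‖x‖ ^ 2)) := by
      apply Integrable.of_integral_ne_zero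
      rw [hIntEq]
      positivity
    rw [← ofReal_integral_eq_lintegral_ofReal hI (by filter_upwards with x; positivity), hIntEq,
      ENNReal.ofReal_rpow_of_pos (by positivity)]
    congr 1
    rw [finrank_euclideanSpace_fin, ENNReal.toReal_inv, ← div_div, Real.div_rpow (by positivity) hz.le,
      Real.div_rpow (by positivity) (by positivity), neg_mul, Real.rpow_neg hz.le, Real.rpow_mul hz.le,
      div_eq_mul_inv, one_div]

lemma hy_exp_nonpos (s K : ℝ) (h : ∀ a : ℝ, 1 ≤ a → a ^ s ≤ K) : s ≤ 0 := by
  by_contra! hs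
  have := tendsto_rpow_atTop hs
  obtain ⟨a, ha, hb⟩ := ((this.eventually_gt_atTop K).and (Filter.eventually_ge_atTop 1)).exists
  exact absurd (h a hb) (not_le.mpr ha)

/-- Necessity. -/
lemma hy_necessity {n : ℕ} (hn : 1 ≤ n) (p q : ℝ≥0∞)
    (hp : 1 ≤ p) (hq : 1 ≤ q) (C : ℝ) (hC : 0 < C)
    (H : ∀ f : SchwartzMap (EuclideanSpace ℝ (Fin n)) ℂ,
        eLpNorm (FourierTransform.fourier (fun x => f x)) q volume ≤
          ENNReal.ofReal C * eLpNorm (fun x => f x) p volume) :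
    1 / p + 1 / q = 1 ∧ p ≤ 2 := by
  obtain ⟨c, hc, hcp⟩ := hy_gauss_norm n p hp
  obtain ⟨d, hd, hdq⟩ := hy_gauss_norm n q hq
  set u := (p⁻¹).toReal with hu
  set v := (q⁻¹).toReal with hv
  have hn' : (0:ℝ) < n := by exact_mod_cast hn
  have key : ∀ z : ℂ, 0 < z.re →
      (π / ‖z‖) ^ (n / 2 : ℝ) * (d * (π ^ 2 * z.re / ‖z‖ ^ 2) ^ (-(n / 2 : ℝ) * v)) ≤
        C * (c * z.re ^ (-(n / 2 : ℝ) * u)) := by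
    intro z hz
    have hz0 : z ≠ 0 := by rintro rfl; simp at hz
    have h := H (hyGauss n z hz)
    simp only [hyGauss_apply] at h
    rw [hcp z hz] at h
    have hre : (π ^ 2 / z : ℂ).re = π ^ 2 * z.re / ‖z‖ ^ 2 := by
      have : (π ^ 2 / z : ℂ) = ((π ^ 2 : ℝ) : ℂ) * z⁻¹ := by push_cast; rfl
      rw [this, Complex.re_ofReal_mul, Complex.inv_re, Complex.normSq_eq_norm_sq]
      ring
    have hpos : 0 < (π ^ 2 / z : ℂ).re := by rw [hre]; positivity
    have e : FourierTransform.fourier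
        (fun x : EuclideanSpace ℝ (Fin n) => Complex.exp (-z * ‖x‖ ^ 2)) =
        ((π / z : ℂ) ^ (n / 2 : ℂ)) • (fun x : EuclideanSpace ℝ (Fin n) =>
          Complex.exp (-(π ^ 2 / z : ℂ) * ‖x‖ ^ 2)) := by
      ext w
      rw [fourier_gaussian_innerProductSpace hz, finrank_euclideanSpace_fin]
      simp only [Pi.smul_apply, smul_eq_mul]
      congr 2
      ring
    rw [e, eLpNorm_const_smul, hdq _ hpos, hre, ← ofReal_norm, ← ENNReal.ofReal_mul (by positivity),
      ← ENNReal.ofReal_mul (by positivity), ENNReal.ofReal_le_ofReal_iff (by positivity)] at h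
    have e2 : ‖(π / z : ℂ) ^ (n / 2 : ℂ)‖ = (π / ‖z‖) ^ (n / 2 : ℝ) := by
      have : (n / 2 : ℂ) = ((n / 2 : ℝ) : ℂ) := by push_cast; rfl
      rw [this, Complex.norm_cpow_real]
      simp [abs_of_pos Real.pi_pos]
    rwa [e2] at h
  have hsum : ∀ a : ℝ, 0 < a → a ^ ((n / 2 : ℝ) * (u + v - 1)) ≤
      C * c / (π ^ (n / 2 : ℝ) * (d * (π ^ 2) ^ (-(n / 2 : ℝ) * v))) := by
    intro a ha
    have h := key a (by simpa using ha)
    simp only [Complex.ofReal_re, Complex.norm_real, Real.norm_eq_abs, abs_of_pos ha] at h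
    rw [le_div_iff₀ (by positivity)]
    have e1 : π ^ 2 * a / a ^ 2 = π ^ 2 * a⁻¹ := by field_simp
    rw [e1, Real.div_rpow (by positivity) ha.le, Real.mul_rpow (by positivity) (by positivity),
      Real.inv_rpow ha.le, ← Real.rpow_neg ha.le] at h
    have e2 : a ^ ((n / 2 : ℝ) * (u + v - 1)) = a ^ ((n / 2 : ℝ) * u) *
        (a ^ (-(-(n / 2 : ℝ) * v)) / a ^ (n / 2 : ℝ)) := by
      rw [← Real.rpow_sub ha, ← Real.rpow_add ha]; congr 1; ring
    have e3 : a ^ ((n / 2 : ℝ) * u) * a ^ (-(n / 2 : ℝ) * u) = 1 := by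
      rw [← Real.rpow_add ha]; simp
    have h2 := mul_le_mul_of_nonneg_left h (show 0 ≤ a ^ ((n / 2 : ℝ) * u) by positivity)
    rw [e2]
    calc _ = _ := by ring
      _ ≤ _ := h2
      _ = C * c * (a ^ ((n / 2 : ℝ) * u) * a ^ (-(n / 2 : ℝ) * u)) := by ring
      _ = _ := by rw [e3]; ring
  have huv : u + v = 1 := by
    have h1 := hy_exp_nonpos _ _ (fun a ha => hsum a (by linarith))
    have h2 := hy_exp_nonpos (-((n / 2 : ℝ) * (u + v - 1))) _ (fun a ha => by
      have := hsum a⁻¹ (by positivity)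
      rwa [Real.inv_rpow (by linarith), ← Real.rpow_neg (by linarith)] at this)
    have h3 : (n / 2 : ℝ) * (u + v - 1) = 0 := by linarith
    rcases mul_eq_zero.mp h3 with h | h
    · linarith
    · linarith
  have hv2 : v ≤ 1 / 2 := by
    have h1 : ∀ a : ℝ, 1 ≤ a → a ^ (-(n / 2 : ℝ) + n * v) ≤
        C * c / (π ^ (n / 2 : ℝ) * (d * (π ^ 2) ^ (-(n / 2 : ℝ) * v))) := by
      intro a ha
      have ha0 : 0 < a := by linarith
      have h := key (1 + (√(a ^ 2 - 1)) * Complex.I) (by simp)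
      have hna : ‖(1 + (√(a ^ 2 - 1)) * Complex.I : ℂ)‖ = a := by
        have := Complex.norm_add_mul_I 1 (√(a ^ 2 - 1))
        rw [Complex.ofReal_one] at this
        rw [this, Real.sq_sqrt (by nlinarith)]
        rw [show (1:ℝ) ^ 2 + (a ^ 2 - 1) = a ^ 2 by ring, Real.sqrt_sq ha0.le]
      have hra : (1 + (√(a ^ 2 - 1)) * Complex.I : ℂ).re = 1 := by simp
      rw [hna, hra, Real.one_rpow, mul_one, mul_one, Real.div_rpow (by positivity) ha0.le,
        Real.div_rpow (by positivity) (by positivity)] at h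
      rw [le_div_iff₀ (by positivity)]
      have e2 : a ^ (-(n / 2 : ℝ) + n * v) = (a ^ (n / 2 : ℝ))⁻¹ *
          ((a ^ 2) ^ (-(n / 2 : ℝ) * v))⁻¹ := by
        rw [← Real.rpow_natCast a 2, ← Real.rpow_mul ha0.le, ← Real.rpow_neg ha0.le,
          ← Real.rpow_neg ha0.le, ← Real.rpow_add ha0]
        congr 1; push_cast; ring
      rw [e2]
      calc _ = _ := by ring
        _ ≤ _ := h
    have h2 := hy_exp_nonpos _ _ h1
    have h3 : (n:ℝ) * v ≤ n * (1 / 2) := by linarith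
    exact le_of_mul_le_mul_left h3 hn'
  have hpi : p⁻¹ ≠ ∞ := by simp; positivity
  have hqi : q⁻¹ ≠ ∞ := by simp; positivity
  constructor
  · rw [one_div, one_div, ← ENNReal.ofReal_toReal hpi, ← ENNReal.ofReal_toReal hqi,
      ← ENNReal.ofReal_add ENNReal.toReal_nonneg ENNReal.toReal_nonneg, ← hu, ← hv, huv,
      ENNReal.ofReal_one]
  · rw [← ENNReal.inv_le_inv, ← ENNReal.ofReal_toReal hpi, ← hu]
    rw [show (2:ℝ≥0∞)⁻¹ = ENNReal.ofReal (1 / 2) by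
      rw [one_div, ENNReal.ofReal_inv_of_pos (by norm_num)]; simp]
    exact ENNReal.ofReal_le_ofReal (by linarith)


lemma hy_fin {n : ℕ} (f : SchwartzMap (EuclideanSpace ℝ (Fin n)) ℂ) (p : ℝ≥0∞) :
    eLpNorm (fun x => f x) p volume ≠ ∞ := by
  have h : MemLp f p volume := f.memLp p volume
  exact h.eLpNorm_ne_top

lemma hy_plancherel {n : ℕ} (f : SchwartzMap (EuclideanSpace ℝ (Fin n)) ℂ) :
    eLpNorm (fun ξ => FourierTransform.fourier f ξ) 2 volume = eLpNorm (fun x => f x) 2 volume := by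
  have h := SchwartzMap.norm_fourier_toL2_eq f
  rw [SchwartzMap.norm_toLp, SchwartzMap.norm_toLp] at h
  exact (ENNReal.toReal_eq_toReal_iff' (hy_fin _ _) (hy_fin _ _)).mp h

lemma hy_sup {n : ℕ} (f : SchwartzMap (EuclideanSpace ℝ (Fin n)) ℂ)
    (ξ : EuclideanSpace ℝ (Fin n)) :
    ‖FourierTransform.fourier f ξ‖ₑ ≤ ∫⁻ x, ‖f x‖ₑ := by
  have h := SchwartzMap.norm_fourier_apply_le_toLp_one f ξ
  rw [SchwartzMap.norm_toLp] at h
  rw [← eLpNorm_one_eq_lintegral_enorm, ← ofReal_norm]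
  exact ENNReal.ofReal_le_of_le_toReal h

/-- Smooth truncation of a Schwartz function. -/
lemma hy_trunc {n : ℕ} (f : SchwartzMap (EuclideanSpace ℝ (Fin n)) ℂ) (r : ℝ) (hr : 0 < r) :
    ∃ g h : SchwartzMap (EuclideanSpace ℝ (Fin n)) ℂ, f = g + h ∧
      (∀ x, ‖g x‖ ≤ ‖f x‖) ∧ (∀ x, ‖h x‖ ≤ ‖f x‖) ∧
      (∀ x, ‖f x‖ ≤ r → g x = 0) ∧ (∀ x, 2 * r < ‖f x‖ → h x = 0) := by
  let φ : ContDiffBump (0 : ℂ) := ⟨r, 2 * r, hr, by linarith⟩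
  have hφ : (fun z : ℂ => φ z).HasTemperateGrowth :=
    φ.hasCompactSupport.hasTemperateGrowth φ.contDiff
  have hφf : (fun x => ((φ (f x) : ℝ) : ℂ)).HasTemperateGrowth :=
    Function.Complex.hasTemperateGrowth_ofReal.comp (hφ.comp f.hasTemperateGrowth)
  let h := SchwartzMap.smulLeftCLM ℂ (fun x => ((φ (f x) : ℝ) : ℂ)) f
  have hh : ∀ x, h x = (φ (f x) : ℝ) * f x := fun x => by
    simp only [h]
    rw [SchwartzMap.smulLeftCLM_apply_apply hφf, smul_eq_mul]
  have hg : ∀ x, (f - h) x = ((1 - φ (f x) : ℝ) : ℂ) * f x := fun x => by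
    rw [sub_apply, hh]; push_cast; ring
  refine ⟨f - h, h, by simp, fun x => ?_, fun x => ?_, fun x hx => ?_, fun x hx => ?_⟩
  · rw [hg, norm_mul, Complex.norm_real, Real.norm_eq_abs]
    have h1 : |1 - φ (f x)| ≤ 1 := by
      rw [abs_le]; constructor <;> linarith [φ.nonneg (x := f x), φ.le_one (x := f x)]
    exact mul_le_of_le_one_left (norm_nonneg _) h1
  · rw [hh, norm_mul, Complex.norm_real, Real.norm_eq_abs]
    have h1 : |φ (f x)| ≤ 1 := by
      rw [abs_le]; constructor <;> linarith [φ.nonneg (x := f x), φ.le_one (x := f x)]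
    exact mul_le_of_le_one_left (norm_nonneg _) h1
  · rw [hg, φ.one_of_mem_closedBall (by simpa using hx)]
    simp
  · rw [hh, φ.zero_of_le_dist (by simpa using hx.le)]
    simp

/-- Weak type estimate. -/
lemma hy_weak {n : ℕ} (f : SchwartzMap (EuclideanSpace ℝ (Fin n)) ℂ) (P N : ℝ) (hP : 1 < P)
    (hN : 0 < N) (hfN : ∫⁻ x, ENNReal.ofReal (‖f x‖ ^ P) = ENNReal.ofReal N)
    (t : ℝ) (ht : 0 < t) :
    volume {ξ | t < ‖FourierTransform.fourier f ξ‖} ≤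
      ∫⁻ x, ENNReal.ofReal
        (if t * ‖f x‖ ^ (P - 1) ≤ 2 ^ P * N then 4 / t ^ 2 * ‖f x‖ ^ 2 else 0) := by
  set r : ℝ := (2 * N / t) ^ (P - 1)⁻¹ with hr
  have hP1 : 0 < P - 1 := by linarith
  have hr0 : 0 < r := by positivity
  have hrP : r ^ (P - 1) = 2 * N / t := by
    rw [hr, ← Real.rpow_mul (by positivity), inv_mul_cancel₀ hP1.ne', Real.rpow_one]
  obtain ⟨g, h, hfgh, hg, hh, hg0, hh0⟩ := hy_trunc f r hr0
  have hgsup : ∀ ξ, ‖FourierTransform.fourier g ξ‖ ≤ t / 2 := by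
    intro ξ
    have h1 : ∫⁻ x, ‖g x‖ₑ ≤ ENNReal.ofReal (t / 2) := by
      calc ∫⁻ x, ‖g x‖ₑ ≤ ∫⁻ x, ENNReal.ofReal (t / (2 * N)) * ENNReal.ofReal (‖f x‖ ^ P) := by
            apply lintegral_mono
            intro x
            simp only
            rw [← ENNReal.ofReal_mul (by positivity), ← ofReal_norm]
            apply ENNReal.ofReal_le_ofReal
            by_cases hx : ‖f x‖ ≤ r
            · rw [hg0 x hx, norm_zero]; positivity
            · push Not at hx
              have hf0 : 0 < ‖f x‖ := hr0.trans hx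
              have h2 : 2 * N / t ≤ ‖f x‖ ^ (P - 1) := by
                rw [← hrP]; gcongr
              have h3 : ‖f x‖ ^ P = ‖f x‖ ^ (P - 1) * ‖f x‖ := by
                rw [← Real.rpow_add_one hf0.ne']; congr 1; ring
              calc ‖g x‖ ≤ ‖f x‖ := hg x
                _ = t / (2 * N) * (2 * N / t * ‖f x‖) := by field_simp
                _ ≤ t / (2 * N) * (‖f x‖ ^ (P - 1) * ‖f x‖) := by gcongr
                _ = _ := by rw [h3]
        _ = ENNReal.ofReal (t / (2 * N)) * ENNReal.ofReal N := by
            rw [lintegral_const_mul' _ _ ENNReal.ofReal_ne_top, hfN]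
        _ = ENNReal.ofReal (t / 2) := by
            rw [← ENNReal.ofReal_mul (by positivity)]; congr 1; field_simp
    have h2 := (hy_sup g ξ).trans h1
    rw [← ofReal_norm] at h2
    exact (ENNReal.ofReal_le_ofReal_iff (by positivity)).mp h2
  have hsub : {ξ | t < ‖FourierTransform.fourier f ξ‖} ⊆
      {ξ | ENNReal.ofReal (t / 2) ≤ ‖FourierTransform.fourier h ξ‖ₑ} := by
    intro ξ hξ
    simp only [Set.mem_ofPred_eq] at hξ ⊢
    rw [← ofReal_norm]
    apply ENNReal.ofReal_le_ofReal
    have e : FourierTransform.fourier f ξ =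
        FourierTransform.fourier g ξ + FourierTransform.fourier h ξ := by
      rw [hfgh, FourierTransform.fourier_add]; rfl
    have := norm_add_le (FourierTransform.fourier g ξ) (FourierTransform.fourier h ξ)
    rw [← e] at this
    linarith [hgsup ξ]
  refine (measure_mono hsub).trans ?_
  have hch := mul_meas_ge_le_pow_eLpNorm' (p := 2) volume (by norm_num) (by norm_num)
    (f := fun ξ => FourierTransform.fourier h ξ)
    ((FourierTransform.fourier h).continuous.aestronglyMeasurable) (ENNReal.ofReal (t / 2))
  rw [hy_plancherel, eLpNorm_eq_lintegral_rpow_enorm_toReal (by norm_num) (by norm_num),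
    ← ENNReal.rpow_mul] at hch
  simp only [ENNReal.toReal_ofNat, one_div, ne_eq, OfNat.ofNat_ne_zero, not_false_eq_true,
    inv_mul_cancel₀, ENNReal.rpow_one] at hch
  have e4 : ENNReal.ofReal (4 / t ^ 2) * (ENNReal.ofReal (t / 2)) ^ (2:ℝ) = 1 := by
    rw [ENNReal.ofReal_rpow_of_pos (by positivity), ← ENNReal.ofReal_mul (by positivity),
      ← ENNReal.ofReal_one]
    congr 1
    rw [Real.rpow_two]
    field_simp
    norm_num
  calc volume {ξ | ENNReal.ofReal (t / 2) ≤ ‖FourierTransform.fourier h ξ‖ₑ}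
      = ENNReal.ofReal (4 / t ^ 2) * ((ENNReal.ofReal (t / 2)) ^ (2:ℝ) *
        volume {ξ | ENNReal.ofReal (t / 2) ≤ ‖FourierTransform.fourier h ξ‖ₑ}) := by
        rw [← mul_assoc, e4, one_mul]
    _ ≤ ENNReal.ofReal (4 / t ^ 2) * ∫⁻ x, ‖h x‖ₑ ^ (2:ℝ) := by gcongr
    _ = ∫⁻ x, ENNReal.ofReal (4 / t ^ 2) * ‖h x‖ₑ ^ (2:ℝ) := by
        rw [lintegral_const_mul' _ _ ENNReal.ofReal_ne_top]
    _ ≤ _ := by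
        apply lintegral_mono
        intro x
        simp only
        rw [← ofReal_norm, ENNReal.ofReal_rpow_of_nonneg (norm_nonneg _) (by norm_num),
          ← ENNReal.ofReal_mul (by positivity), Real.rpow_two]
        apply ENNReal.ofReal_le_ofReal
        by_cases hx : ‖f x‖ ≤ 2 * r
        · rw [if_pos]
          · have := hh x
            gcongr
          · calc t * ‖f x‖ ^ (P - 1) ≤ t * (2 * r) ^ (P - 1) := by gcongr
              _ = 2 ^ (P - 1) * 2 * N := by
                rw [Real.mul_rpow (by norm_num) hr0.le, hrP]; field_simp
              _ = 2 ^ P * N := by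
                rw [← Real.rpow_add_one (by norm_num)]; congr 2; ring
              _ ≤ _ := le_rfl
        · push Not at hx
          rw [hh0 x hx]
          simp only [norm_zero, ne_eq, OfNat.ofNat_ne_zero, not_false_eq_true, zero_pow, mul_zero]
          split_ifs
          · positivity
          · exact le_rfl

lemma hy_inner (Q M a s : ℝ) (hQ : 2 < Q) (hM : 0 < M) (ha : 0 < a) :
    ∫⁻ t in Set.Ioi (0:ℝ), ENNReal.ofReal
      ((if t * a ≤ M then 4 / t ^ 2 * s ^ 2 else 0) * t ^ (Q - 1)) ≤
      ENNReal.ofReal (4 * s ^ 2 * ((M / a) ^ (Q - 2) / (Q - 2))) := by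
  have hMa : 0 < M / a := by positivity
  have hii := (intervalIntegral.intervalIntegrable_rpow' (a := 0) (b := M / a)
    (r := Q - 3) (by linarith)).const_mul (4 * s ^ 2)
  have hIntEq : ∫ t in (0:ℝ)..(M / a), 4 * s ^ 2 * t ^ (Q - 3) =
      4 * s ^ 2 * ((M / a) ^ (Q - 2) / (Q - 2)) := by
    rw [intervalIntegral.integral_const_mul, integral_rpow (Or.inl (by linarith)),
      show Q - 3 + 1 = Q - 2 by ring, Real.zero_rpow (by linarith), sub_zero]
  rw [← hIntEq, intervalIntegral.integral_of_le hMa.le, ofReal_integral_eq_lintegral_ofReal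
    ((intervalIntegrable_iff_integrableOn_Ioc_of_le hMa.le).mp hii)
    ((ae_restrict_iff' measurableSet_Ioc).mpr (by
      filter_upwards with t ht
      have := ht.1
      simp only [Pi.zero_apply]
      positivity))]
  rw [← lintegral_indicator measurableSet_Ioi, ← lintegral_indicator measurableSet_Ioc]
  apply lintegral_mono
  intro t
  simp only [Set.indicator]
  by_cases ht : t ∈ Set.Ioi (0:ℝ)
  · have ht0 : 0 < t := ht
    rw [if_pos ht]
    by_cases h2 : t * a ≤ M
    · rw [if_pos h2, if_pos ⟨ht, (le_div_iff₀ ha).mpr h2⟩]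
      apply le_of_eq
      congr 1
      rw [show Q - 1 = (Q - 3) + 2 by ring, Real.rpow_add ht0, Real.rpow_two]
      field_simp
    · rw [if_neg h2]; simp
  · rw [if_neg ht]; simp

lemma hy_strong {n : ℕ} (f : SchwartzMap (EuclideanSpace ℝ (Fin n)) ℂ) (P Q N : ℝ) (hP : 1 < P)
    (hQ : 2 < Q) (hPQ : (P - 1) * (Q - 1) = 1)
    (hN : 0 < N) (hfN : ∫⁻ x, ENNReal.ofReal (‖f x‖ ^ P) = ENNReal.ofReal N) :
    ∫⁻ ξ, ENNReal.ofReal (‖FourierTransform.fourier f ξ‖ ^ Q) ≤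
      ENNReal.ofReal (Q * (4 * (2 ^ P) ^ (Q - 2) / (Q - 2)) * N ^ (Q - 1)) := by
  rw [lintegral_rpow_eq_lintegral_meas_lt_mul volume (by filter_upwards with x; positivity)
    (by exact ((FourierTransform.fourier f).continuous.norm).measurable.aemeasurable)
    (by linarith)]
  have hQ0 : 0 < Q - 2 := by linarith
  set M := 2 ^ P * N with hM
  have hM0 : 0 < M := by positivity
  have step1 : ∫⁻ t in Set.Ioi (0:ℝ), volume {ξ | t < ‖FourierTransform.fourier f ξ‖} *
      ENNReal.ofReal (t ^ (Q - 1)) ≤ ∫⁻ t in Set.Ioi (0:ℝ), ∫⁻ x, ENNReal.ofReal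
        ((if t * ‖f x‖ ^ (P - 1) ≤ M then 4 / t ^ 2 * ‖f x‖ ^ 2 else 0) * t ^ (Q - 1)) := by
    apply setLIntegral_mono' measurableSet_Ioi
    intro t ht
    have ht0 : 0 < t := ht
    refine (mul_le_mul_left (hy_weak f P N hP hN hfN t ht) _).trans ?_
    rw [← lintegral_mul_const' _ _ ENNReal.ofReal_ne_top]
    apply le_of_eq
    apply lintegral_congr
    intro x
    rw [← ENNReal.ofReal_mul]
    split_ifs
    · positivity
    · exact le_rfl
  have hmeas : Measurable (Function.uncurry fun (t : ℝ) (x : EuclideanSpace ℝ (Fin n)) =>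
      ENNReal.ofReal ((if t * ‖f x‖ ^ (P - 1) ≤ M then 4 / t ^ 2 * ‖f x‖ ^ 2 else 0)
        * t ^ (Q - 1))) := by
    have hf : Measurable (fun x => ‖f x‖) := f.continuous.norm.measurable
    have hf2 : Measurable (fun y : ℝ × EuclideanSpace ℝ (Fin n) => ‖f y.2‖) :=
      hf.comp measurable_snd
    apply Measurable.ennreal_ofReal
    apply Measurable.mul
    · apply Measurable.ite
      · exact measurableSet_le (measurable_fst.mul (hf2.pow_const _)) measurable_const
      · exact (measurable_const.div (measurable_fst.pow_const 2)).mul (hf2.pow_const 2)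
      · exact measurable_const
    · exact measurable_fst.pow_const _
  have step2 : ∀ x, ∫⁻ t in Set.Ioi (0:ℝ), ENNReal.ofReal
      ((if t * ‖f x‖ ^ (P - 1) ≤ M then 4 / t ^ 2 * ‖f x‖ ^ 2 else 0) * t ^ (Q - 1)) ≤
      ENNReal.ofReal (4 * M ^ (Q - 2) / (Q - 2)) * ENNReal.ofReal (‖f x‖ ^ P) := by
    intro x
    by_cases hx : ‖f x‖ = 0
    · simp [hx]
    · have hx0 : 0 < ‖f x‖ := lt_of_le_of_ne (norm_nonneg _) (Ne.symm hx)
      refine (hy_inner Q M (‖f x‖ ^ (P - 1)) ‖f x‖ hQ hM0 (by positivity)).trans ?_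
      rw [← ENNReal.ofReal_mul (by positivity)]
      apply ENNReal.ofReal_le_ofReal
      apply le_of_eq
      rw [Real.div_rpow hM0.le (by positivity), ← Real.rpow_mul hx0.le]
      have e : ‖f x‖ ^ 2 = ‖f x‖ ^ P * ‖f x‖ ^ ((P - 1) * (Q - 2)) := by
        rw [← Real.rpow_add hx0, ← Real.rpow_two]
        congr 1
        linarith
      rw [e]
      field_simp
  calc _ ≤ ENNReal.ofReal Q * ∫⁻ t in Set.Ioi (0:ℝ), ∫⁻ x, ENNReal.ofReal
        ((if t * ‖f x‖ ^ (P - 1) ≤ M then 4 / t ^ 2 * ‖f x‖ ^ 2 else 0) * t ^ (Q - 1)) := by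
        gcongr
    _ = ENNReal.ofReal Q * ∫⁻ x, ∫⁻ t in Set.Ioi (0:ℝ), ENNReal.ofReal
        ((if t * ‖f x‖ ^ (P - 1) ≤ M then 4 / t ^ 2 * ‖f x‖ ^ 2 else 0) * t ^ (Q - 1)) := by
        rw [lintegral_lintegral_swap hmeas.aemeasurable]
    _ ≤ ENNReal.ofReal Q * ∫⁻ x, ENNReal.ofReal (4 * M ^ (Q - 2) / (Q - 2)) *
          ENNReal.ofReal (‖f x‖ ^ P) := by
        gcongr with x
        exact step2 x
    _ = ENNReal.ofReal Q * (ENNReal.ofReal (4 * M ^ (Q - 2) / (Q - 2)) * ENNReal.ofReal N) := by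
        rw [lintegral_const_mul' _ _ ENNReal.ofReal_ne_top, hfN]
    _ = _ := by
        rw [← ENNReal.ofReal_mul (by positivity), ← ENNReal.ofReal_mul (by linarith)]
        congr 1
        rw [hM, Real.mul_rpow (by positivity) hN.le, show Q - 1 = Q - 2 + 1 by ring,
          Real.rpow_add_one hN.ne']
        ring

lemma hy_norm_eq {n : ℕ} (f : SchwartzMap (EuclideanSpace ℝ (Fin n)) ℂ) (p : ℝ≥0∞)
    (hp0 : 1 ≤ p) (hpt : p ≠ ∞) :
    eLpNorm (fun x => f x) p volume =
      (∫⁻ x, ENNReal.ofReal (‖f x‖ ^ p.toReal)) ^ (1 / p.toReal) := by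
  rw [eLpNorm_eq_lintegral_rpow_enorm_toReal (by positivity) hpt]
  congr 2
  ext x
  rw [← ofReal_norm, ENNReal.ofReal_rpow_of_nonneg (norm_nonneg _) ENNReal.toReal_nonneg]

lemma hy_sufficiency {n : ℕ} (p q : ℝ≥0∞) (hp : 1 ≤ p) (hq : 1 ≤ q)
    (hpq : 1 / p + 1 / q = 1) (hp2 : p ≤ 2) :
    ∃ C : ℝ, 0 < C ∧ ∀ f : SchwartzMap (EuclideanSpace ℝ (Fin n)) ℂ,
        eLpNorm (fun ξ => FourierTransform.fourier f ξ) q volume ≤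
          ENNReal.ofReal C * eLpNorm (fun x => f x) p volume := by
  rw [one_div, one_div] at hpq
  rcases eq_or_lt_of_le hp with h1 | h1
  · subst h1
    have hq' : q = ∞ := by
      rw [inv_one] at hpq
      have : q⁻¹ = 0 := by
        have h2 : (1:ℝ≥0∞) + q⁻¹ = 1 + 0 := by rw [hpq, add_zero]
        exact (ENNReal.add_right_inj ENNReal.one_ne_top).mp h2
      simpa using this
    subst hq'
    refine ⟨1, one_pos, fun f => ?_⟩
    rw [ENNReal.ofReal_one, one_mul, eLpNorm_exponent_top, eLpNorm_one_eq_lintegral_enorm]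
    apply eLpNormEssSup_le_of_ae_enorm_bound
    filter_upwards with ξ
    exact hy_sup f ξ
  have hpt : p ≠ ∞ := ne_top_of_le_ne_top (by norm_num) hp2
  have hqt : q ≠ ∞ := by
    rintro rfl
    rw [inv_top, add_zero, ENNReal.inv_eq_one] at hpq
    exact h1.ne' hpq
  have hP : 1 < p.toReal := by
    rw [← ENNReal.toReal_one]; exact (ENNReal.toReal_lt_toReal (by norm_num) hpt).mpr h1
  have hQ1 : 1 ≤ q.toReal := by
    rw [← ENNReal.toReal_one]; exact (ENNReal.toReal_le_toReal (by norm_num) hqt).mpr hq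
  have hR : p.toReal⁻¹ + q.toReal⁻¹ = 1 := by
    rw [← ENNReal.toReal_inv, ← ENNReal.toReal_inv, ← ENNReal.toReal_add, hpq, ENNReal.toReal_one]
    · simp; positivity
    · simp; positivity
  have hPQ : (p.toReal - 1) * (q.toReal - 1) = 1 := by
    have : p.toReal ≠ 0 := by linarith
    have : q.toReal ≠ 0 := by linarith
    field_simp at hR
    linarith
  rcases eq_or_lt_of_le hp2 with h2 | h2
  · subst h2
    have hq2 : q = 2 := by
      rw [← ENNReal.toReal_eq_toReal_iff' hqt (by norm_num)]
      simp only [ENNReal.toReal_ofNat] at hPQ ⊢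
      linarith
    subst hq2
    refine ⟨1, one_pos, fun f => ?_⟩
    rw [ENNReal.ofReal_one, one_mul]
    exact (hy_plancherel f).le
  have hP2 : p.toReal < 2 := by
    have := (ENNReal.toReal_lt_toReal hpt (by norm_num)).mpr h2
    simpa using this
  have hQ : 2 < q.toReal := by nlinarith
  set P := p.toReal
  set Q := q.toReal
  have hQ0 : 0 < Q - 2 := by linarith
  set K : ℝ := Q * (4 * (2 ^ P) ^ (Q - 2) / (Q - 2)) with hK
  have hK0 : 0 < K := by positivity
  refine ⟨K ^ (1 / Q), by positivity, fun f => ?_⟩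
  have hfin : ∫⁻ x, ENNReal.ofReal (‖f x‖ ^ P) ≠ ∞ := by
    intro h
    have h3 := hy_norm_eq f p hp hpt
    rw [h, ENNReal.top_rpow_of_pos (by positivity)] at h3
    exact hy_fin f p h3
  obtain ⟨N, hN0, hN⟩ : ∃ N : ℝ, 0 ≤ N ∧ ∫⁻ x, ENNReal.ofReal (‖f x‖ ^ P) = ENNReal.ofReal N :=
    ⟨_, ENNReal.toReal_nonneg, (ENNReal.ofReal_toReal hfin).symm⟩
  rcases eq_or_lt_of_le hN0 with h0 | hNpos
  · subst h0
    have hz : eLpNorm (fun x => f x) p volume = 0 := by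
      rw [hy_norm_eq f p hp hpt, hN, ENNReal.ofReal_zero, ENNReal.zero_rpow_of_pos (by positivity)]
    have hae := (eLpNorm_eq_zero_iff f.continuous.aestronglyMeasurable (by positivity)).mp hz
    have hFz : ∀ ξ, FourierTransform.fourier f ξ = 0 := by
      intro ξ
      have h4 := hy_sup f ξ
      have h5 : ∫⁻ x, ‖f x‖ₑ = 0 := by
        rw [lintegral_eq_zero_iff' (f.continuous.enorm.measurable.aemeasurable)]
        filter_upwards [hae] with x hx
        simpa using hx
      rw [h5] at h4
      simpa using h4
    simp [hFz]
  · rw [hy_norm_eq f p hp hpt, hy_norm_eq (FourierTransform.fourier f) q hq hqt]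
    have hs := hy_strong f P Q N hP hQ hPQ hNpos hN
    rw [hN, ENNReal.ofReal_rpow_of_pos hNpos, ← ENNReal.ofReal_mul (by positivity)]
    calc _ ≤ (ENNReal.ofReal (K * N ^ (Q - 1))) ^ (1 / Q) := by gcongr
      _ = _ := by
        rw [ENNReal.ofReal_rpow_of_pos (by positivity), Real.mul_rpow hK0.le (by positivity),
          ← Real.rpow_mul hNpos.le]
        congr 3
        change (Q - 1) * (1 / Q) = 1 / P
        have : P ≠ 0 := by linarith
        have : Q ≠ 0 := by linarith
        field_simp
        linarith

/-- **Restriction to all of `ℝ^n` (sharp Hausdorff–Young range).**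
For `n ≥ 1` and `1 ≤ p, q ≤ ∞`, there is a constant `C > 0` with
`‖f̂‖_{L^q(ℝ^n)} ≤ C ‖f‖_{L^p(ℝ^n)}` for every Schwartz `f` if and only if
`1/p + 1/q = 1` and `1 ≤ p ≤ 2`. -/
theorem restriction_whole_space {n : ℕ} (hn : 1 ≤ n) (p q : ℝ≥0∞)
    (hp : 1 ≤ p) (hq : 1 ≤ q) :
    (∃ C : ℝ, 0 < C ∧
      ∀ f : SchwartzMap (EuclideanSpace ℝ (Fin n)) ℂ,
        eLpNorm (fourierTransformE (fun x => f x)) q volume ≤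
          ENNReal.ofReal C * eLpNorm (fun x => f x) p volume) ↔
    (1 / p + 1 / q = 1 ∧ p ≤ 2) := by
  constructor
  · rintro ⟨C, hC, H⟩
    refine hy_necessity hn p q hp hq C hC (fun f => ?_)
    have h := H f
    rwa [show fourierTransformE (fun x => f x) = FourierTransform.fourier (fun x => f x) from
      hy_fourier_eq _] at h
  · rintro ⟨hpq, hp2⟩
    obtain ⟨C, hC, H⟩ := hy_sufficiency (n := n) p q hp hq hpq hp2
    refine ⟨C, hC, fun f => ?_⟩
    rw [show fourierTransformE (fun x => f x) = FourierTransform.fourier (fun x => f x) from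
      hy_fourier_eq _]
    exact H f
end

section
/- (Stein–Tomas restriction theorem for the paraboloid.) Let n ≥ 2 and 1 ≤ p ≤ 2(n+1)/(n+3). There exists a constant C = C(n, p) such that for every Schwartz function f : ℝ^n → ℂ, (∫_{[−1,1]^{n−1}} |f̂(ξ, |ξ|²)|² dξ)^{1/2} ≤ C ‖f‖_{L^p(ℝ^n)}. -/
open MeasureTheory Real Complex RealInnerProductSpace

/-- The Fourier transform `f̂(ξ, t) = ∫ f(x) e^{−2πi(x′·ξ + x_n t)} dx` on
`ℝ^n = ℝ^{n−1} × ℝ`. -/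
noncomputable def fourierParab {m : ℕ} (f : EuclideanSpace ℝ (Fin m) × ℝ → ℂ)
    (ξ : EuclideanSpace ℝ (Fin m) × ℝ) : ℂ :=
  ∫ x : EuclideanSpace ℝ (Fin m) × ℝ,
    f x * Complex.exp (-2 * Real.pi * Complex.I * ((⟪x.1, ξ.1⟫ + x.2 * ξ.2 : ℝ)))


open scoped ComplexConjugate in
theorem quad_form {X Z : Type*} [MeasurableSpace X] [MeasurableSpace Z] {ν : Measure X} {μ : Measure Z}
    [SFinite ν] [SFinite μ] (w : X → ℂ) (hw : Integrable w ν) (f : Z → ℂ) (hf : Integrable f μ)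
    (e : X → Z → ℂ) (he : Measurable (Function.uncurry e)) (he1 : ∀ x z, ‖e x z‖ ≤ 1) :
    ∫ x, w x * ((∫ z, f z * e x z ∂μ) * conj (∫ z, f z * e x z ∂μ)) ∂ν =
      ∫ z, ∫ z', f z * (conj (f z') * ∫ x, w x * (e x z * conj (e x z')) ∂ν) ∂μ ∂μ ∧
    Integrable (fun x => w x * ((∫ z, f z * e x z ∂μ) * conj (∫ z, f z * e x z ∂μ))) ν := by
  have hfc : Integrable (fun z => conj (f z)) μ := 
    ⟨Complex.continuous_conj.comp_aestronglyMeasurable hf.1, by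
      refine hf.2.mono ?_
      simp⟩
  have hint : Integrable (fun q : X × (Z × Z) => (w q.1 * (f q.2.1 * conj (f q.2.2))) * 
      (e q.1 q.2.1 * conj (e q.1 q.2.2))) (ν.prod (μ.prod μ)) := by
    refine (hw.mul_prod (hf.mul_prod hfc)).mul_bdd (c := 1) ?_ ?_
    · apply Measurable.aestronglyMeasurable
      have h1 : Measurable (fun q : X × (Z × Z) => e q.1 q.2.1) := 
        he.comp (measurable_fst.prodMk (measurable_fst.comp measurable_snd))
      have h2 : Measurable (fun q : X × (Z × Z) => e q.1 q.2.2) := 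
        he.comp (measurable_fst.prodMk (measurable_snd.comp measurable_snd))
      exact h1.mul (Complex.continuous_conj.measurable.comp h2)
    · refine Filter.Eventually.of_forall fun q => ?_
      rw [norm_mul, RCLike.norm_conj]
      exact mul_le_one₀ (he1 _ _) (norm_nonneg _) (he1 _ _)
  have hint2 : Integrable (fun q : Z × Z => ∫ x, w x * (f q.1 * conj (f q.2)) * 
      (e x q.1 * conj (e x q.2)) ∂ν) (μ.prod μ) := hint.integral_prod_right
  have hpt : ∀ x, w x * ((∫ z, f z * e x z ∂μ) * conj (∫ z, f z * e x z ∂μ)) =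
      ∫ q : Z × Z, w x * (f q.1 * conj (f q.2)) * (e x q.1 * conj (e x q.2)) ∂(μ.prod μ) := by
    intro x
    rw [← integral_conj, ← integral_prod_mul, ← integral_const_mul]
    congr 1; ext q; simp; ring
  refine ⟨?_, by simp_rw [hpt]; exact hint.integral_prod_left⟩
  calc _ = ∫ x, ∫ q : Z × Z, w x * (f q.1 * conj (f q.2)) * 
      (e x q.1 * conj (e x q.2)) ∂(μ.prod μ) ∂ν := by simp_rw [hpt]
    _ = ∫ q : Z × Z, ∫ x, w x * (f q.1 * conj (f q.2)) * 
      (e x q.1 * conj (e x q.2)) ∂ν ∂(μ.prod μ) := integral_integral_swap hint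
    _ = ∫ z, ∫ z', ∫ x, w x * (f z * conj (f z')) * 
      (e x z * conj (e x z')) ∂ν ∂μ ∂μ := integral_prod _ hint2
    _ = _ := by
      congr 1; ext z; congr 1; ext z'
      rw [← integral_const_mul, ← integral_const_mul]
      congr 1; ext x; ring

open scoped ComplexConjugate in
theorem quad_bound {X Z : Type*} [MeasurableSpace X] [MeasurableSpace Z] {ν : Measure X} {μ : Measure Z}
    [SFinite ν] [SFinite μ] (w : X → ℝ) (hw0 : ∀ x, 0 ≤ w x)
    (hw : Integrable (fun x => (w x : ℂ)) ν) (f : Z → ℂ) (hf : Integrable f μ)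
    (e : X → Z → ℂ) (he : Measurable (Function.uncurry e)) (he1 : ∀ x z, ‖e x z‖ ≤ 1) :
    ∫⁻ x, ENNReal.ofReal (w x) * ‖∫ z, f z * e x z ∂μ‖ₑ ^ 2 ∂ν =
      ‖∫ z, ∫ z', f z * (conj (f z') * ∫ x, w x * (e x z * conj (e x z')) ∂ν) ∂μ ∂μ‖ₑ := by
  obtain ⟨h1, h2⟩ := quad_form (fun x => (w x : ℂ)) hw f hf e he he1
  rw [← h1]
  have key : ∀ x, (w x : ℂ) * ((∫ z, f z * e x z ∂μ) * conj (∫ z, f z * e x z ∂μ)) = 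
      ((w x * ‖∫ z, f z * e x z ∂μ‖ ^ 2 : ℝ) : ℂ) := by
    intro x
    rw [Complex.mul_conj, Complex.normSq_eq_norm_sq]; push_cast; rfl
  have h2' : Integrable (fun x => w x * ‖∫ z, f z * e x z ∂μ‖ ^ 2) ν := by
    have := h2.re
    simp_rw [key] at this
    simpa only [RCLike.re_to_complex, Complex.ofReal_re] using this
  simp_rw [key]
  rw [integral_complex_ofReal]
  have h0 : ∀ x, 0 ≤ w x * ‖∫ z, f z * e x z ∂μ‖ ^ 2 := fun x => mul_nonneg (hw0 x) (by positivity)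
  rw [← ofReal_norm, Complex.norm_real, Real.norm_of_nonneg (integral_nonneg h0),
    ofReal_integral_eq_lintegral_ofReal h2' (Filter.Eventually.of_forall h0)]
  congr 1; ext x
  rw [ENNReal.ofReal_mul (hw0 x), ENNReal.ofReal_pow (norm_nonneg _), ofReal_norm]

/-- the kernel -/
noncomputable def gk (V : Type*) [NormedAddCommGroup V] [InnerProductSpace ℝ V] (τ : ℝ) (x : V) : ℂ :=
  (π / (π * (1 + 2 * τ * I) : ℂ)) ^ (Module.finrank ℝ V / 2 : ℂ) * 
    cexp (-π ^ 2 * ‖x‖ ^ 2 / (π * (1 + 2 * τ * I)))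

section
set_option linter.unusedSectionVars false
variable {V : Type*} [NormedAddCommGroup V] [InnerProductSpace ℝ V] [FiniteDimensional ℝ V]
  [MeasurableSpace V] [BorelSpace V]

theorem gk_eq (τ : ℝ) (x : V) :
    ∫ ξ : V, (rexp (-π * ‖ξ‖ ^ 2) : ℂ) * cexp (-2 * π * I * ((⟪x, ξ⟫ + τ * ‖ξ‖ ^ 2 : ℝ))) = gk V τ x := by
  have h := GaussianFourier.integral_cexp_neg_mul_sq_norm_add (V := V) (b := π * (1 + 2 * τ * I))
    (by simp [pi_pos]) (-2 * π * I) x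
  unfold gk
  convert! h using 1
  · congr 1; ext ξ
    rw [Complex.ofReal_exp, ← Complex.exp_add]
    congr 1
    push_cast
    ring
  · congr 2
    have : (-2 * π * I : ℂ) ^ 2 = 4 * (-π ^ 2) := by
      ring_nf; simp
    rw [this, mul_assoc (4 : ℂ), mul_div_mul_left _ _ (by norm_num : (4 : ℂ) ≠ 0)]

theorem gk_bound (τ : ℝ) (x : V) : 
    ‖gk V τ x‖ ≤ (1 + 4 * τ ^ 2) ^ (-(Module.finrank ℝ V : ℝ) / 4) := by
  have hz : (1 + 2 * τ * I : ℂ) ≠ 0 := by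
    intro h
    have := congrArg Complex.re h
    simp at this
  have hpi : (π : ℂ) ≠ 0 := by exact_mod_cast pi_ne_zero
  unfold gk
  rw [norm_mul, Complex.norm_exp]
  have h1 : (π / (π * (1 + 2 * τ * I) : ℂ)) = (1 + 2 * τ * I : ℂ)⁻¹ := by
    field_simp
  have h2 : (-π ^ 2 * ‖x‖ ^ 2 / (π * (1 + 2 * τ * I)) : ℂ) = ((-π * ‖x‖^2 : ℝ) : ℂ) * (1 + 2 * τ * I : ℂ)⁻¹ := by
    push_cast; field_simp
  have hns : Complex.normSq (1 + 2 * τ * I : ℂ) = 1 + 4 * τ ^ 2 := by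
    simp [Complex.normSq_apply]; ring
  have hn : ‖(1 + 2 * τ * I : ℂ)‖ = (1 + 4 * τ^2) ^ (1/2 : ℝ) := by
    rw [Complex.norm_def, hns, Real.sqrt_eq_rpow]
  have h3 : ((-π ^ 2 * ‖x‖ ^ 2 / (π * (1 + 2 * τ * I)) : ℂ)).re ≤ 0 := by
    rw [h2, Complex.re_ofReal_mul, Complex.inv_re, hns]
    have : (1 + 2 * τ * I : ℂ).re = 1 := by simp
    rw [this]
    apply mul_nonpos_of_nonpos_of_nonneg
    · have := pi_pos; nlinarith [sq_nonneg ‖x‖]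
    · positivity
  have h4 : (Module.finrank ℝ V / 2 : ℂ) = ((Module.finrank ℝ V / 2 : ℝ) : ℂ) := by push_cast; rfl
  rw [h1, h4, Complex.norm_cpow_real, norm_inv, hn, ← Real.rpow_neg (by positivity), ← Real.rpow_mul (by positivity)]
  calc _ ≤ (1 + 4 * τ ^ 2) ^ (-(1/2) * (Module.finrank ℝ V / 2 : ℝ)) * 1 := by
        gcongr
        exact Real.exp_le_one_iff.mpr h3
    _ = _ := by rw [mul_one]; congr 1; ring

theorem integrable_gauss {b : ℝ} (hb : 0 < b) : Integrable (fun ξ : V => (rexp (-b * ‖ξ‖ ^ 2) : ℂ)) := by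
  have := GaussianFourier.integrable_cexp_neg_mul_sq_norm_add (V := V) (b := b) (by simpa) 0 0
  refine this.congr (Filter.Eventually.of_forall fun ξ => ?_)
  simp

theorem gk_measurable : Measurable (fun q : ℝ × V => gk V q.1 q.2) := by
  unfold gk
  fun_prop
end

section
set_option linter.unusedSectionVars false
variable {V : Type*} [NormedAddCommGroup V] [InnerProductSpace ℝ V] [FiniteDimensional ℝ V]
  [MeasurableSpace V] [BorelSpace V]

theorem lint_gauss {b : ℝ} (hb : 0 < b) : 
    ∫⁻ x : V, ENNReal.ofReal ((π / b) ^ (Module.finrank ℝ V / 2 : ℝ) * rexp (-(π ^ 2 / b) * ‖x‖ ^ 2)) = 1 := by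
  have hc : 0 < π ^ 2 / b := by positivity
  have hi : Integrable (fun x : V => rexp (-(π ^ 2 / b) * ‖x‖ ^ 2)) := by
    have := (integrable_gauss (V := V) hc).re
    simpa only [RCLike.ofReal_re, RCLike.re_to_complex, Complex.ofReal_re] using this
  rw [← ofReal_integral_eq_lintegral_ofReal (hi.const_mul _) (Filter.Eventually.of_forall fun x => by positivity),
    integral_const_mul, GaussianFourier.integral_rexp_neg_mul_sq_norm hc, ← Real.mul_rpow (by positivity) (by positivity)]
  have : π / b * (π / (π ^ 2 / b)) = 1 := by field_simp
  rw [this]; simp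

theorem gker (b : ℝ) (hb : 0 < b) (x : V) :
    ‖∫ ξ : V, (rexp (-b * ‖ξ‖ ^ 2) : ℂ) * cexp (-2 * π * I * (⟪x, ξ⟫ : ℝ))‖ₑ ≤ 
     ENNReal.ofReal ((π / b) ^ (Module.finrank ℝ V / 2 : ℝ) * rexp (-(π ^ 2 / b) * ‖x‖ ^ 2)) := by
  have h := GaussianFourier.integral_cexp_neg_mul_sq_norm_add (V := V) (b := b)
    (by simpa) (-2 * π * I) x
  have h' : ∫ ξ : V, (rexp (-b * ‖ξ‖ ^ 2) : ℂ) * cexp (-2 * π * I * (⟪x, ξ⟫ : ℝ)) = 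
      (((π / b) ^ (Module.finrank ℝ V / 2 : ℝ) * rexp (-(π ^ 2 / b) * ‖x‖ ^ 2) : ℝ) : ℂ) := by
    convert! h using 1
    · congr 1; ext ξ
      rw [Complex.ofReal_exp, ← Complex.exp_add]
      congr 1
      push_cast
      ring
    · push_cast
      rw [Complex.ofReal_cpow (by positivity)]
      push_cast
      congr 2
      have : (-2 * π * I : ℂ) ^ 2 = 4 * (-π ^ 2) := by
        ring_nf; simp
      rw [this, mul_assoc (4 : ℂ), mul_div_mul_left _ _ (by norm_num : (4 : ℂ) ≠ 0)]
      ring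
  rw [h', ← ofReal_norm, Complex.norm_real, Real.norm_of_nonneg (by positivity)]

theorem two_mul_le_sq_ennreal (a b : ENNReal) : 2 * (a * b) ≤ a ^ 2 + b ^ 2 := by
  by_cases ha : a = ⊤
  · simp [ha]
  by_cases hb : b = ⊤
  · simp [hb]
  lift a to NNReal using ha
  lift b to NNReal using hb
  norm_cast
  have := two_mul_le_add_sq a b
  rwa [mul_assoc] at this

open scoped ComplexConjugate FourierTransform in
theorem bessel_gauss (h : V → ℂ) (hh : Integrable h) {b : ℝ} (hb : 0 < b) : 
    ∫⁻ ξ, ENNReal.ofReal (rexp (-b * ‖ξ‖ ^ 2)) * ‖𝓕 h ξ‖ₑ ^ 2 ≤ ∫⁻ x, ‖h x‖ₑ ^ 2 := by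
  have hF : ∀ ξ, 𝓕 h ξ = ∫ x, h x * cexp (-2 * π * I * (⟪x, ξ⟫ : ℝ)) := by
    intro ξ
    rw [Real.fourier_eq']
    congr 1; ext x
    rw [smul_eq_mul, mul_comm]
    congr 2; push_cast; ring
  simp_rw [hF]
  rw [quad_bound (fun ξ : V => rexp (-b * ‖ξ‖ ^ 2)) (fun _ => by positivity) (integrable_gauss hb) h hh
    (fun ξ x => cexp (-2 * π * I * (⟪x, ξ⟫ : ℝ))) (by 
      apply Continuous.measurable
      unfold Function.uncurry
      fun_prop) (by
      intro ξ x
      rw [Complex.norm_exp]; simp)]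
  set G : V → ENNReal := fun x => ENNReal.ofReal ((π / b) ^ (Module.finrank ℝ V / 2 : ℝ) * rexp (-(π ^ 2 / b) * ‖x‖ ^ 2)) with hG
  have hGm : Measurable G := by
    apply ENNReal.measurable_ofReal.comp
    fun_prop
  have hhm : AEMeasurable (fun x => ‖h x‖ₑ) := hh.1.enorm
  have hk : ∀ z z', ‖∫ ξ : V, (rexp (-b * ‖ξ‖ ^ 2) : ℂ) * (cexp (-2 * π * I * (⟪z, ξ⟫ : ℝ)) * conj (cexp (-2 * π * I * (⟪z', ξ⟫ : ℝ))))‖ₑ ≤ G (z - z') := by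
    intro z z'
    refine le_trans (le_of_eq ?_) (gker b hb (z - z'))
    congr 2; ext ξ
    rw [← Complex.exp_conj, ← Complex.exp_add]
    congr 2
    simp [inner_sub_left, Complex.conj_ofNat]
    ring
  have hG1 : ∀ z, ∫⁻ z', G (z - z') = 1 := by
    intro z
    rw [lintegral_sub_left_eq_self G z]
    exact lint_gauss hb
  have hG2 : ∀ z', ∫⁻ z, G (z - z') = 1 := by
    intro z
    rw [lintegral_sub_right_eq_self G z]
    exact lint_gauss hb
  have hG1' : ∀ (c : ENNReal) (z : V), ∫⁻ z', c * G (z - z') = c := by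
    intro c z
    rw [lintegral_const_mul (f := fun z' => G (z - z')) c (hGm.comp (measurable_const.sub measurable_id)), hG1, mul_one]
  have hG2' : ∀ (c : ENNReal) (z : V), ∫⁻ z', c * G (z' - z) = c := by
    intro c z
    rw [lintegral_const_mul (f := fun z' => G (z' - z)) c (hGm.comp (measurable_id.sub measurable_const)), hG2, mul_one]
  have step : 2 * ∫⁻ z, ∫⁻ z', ‖h z‖ₑ * ‖h z'‖ₑ * G (z - z') ≤ 2 * ∫⁻ x, ‖h x‖ₑ ^ 2 := by
    calc _ ≤ ∫⁻ z, ∫⁻ z', (‖h z‖ₑ ^ 2 * G (z - z') + ‖h z'‖ₑ ^ 2 * G (z - z')) := by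
          rw [← lintegral_const_mul' _ _ (by simp)]
          gcongr with z
          rw [← lintegral_const_mul' _ _ (by simp)]
          gcongr with z'
          rw [← add_mul, ← mul_assoc]
          gcongr
          exact two_mul_le_sq_ennreal _ _
      _ = (∫⁻ z, ∫⁻ z', ‖h z‖ₑ ^ 2 * G (z - z')) + ∫⁻ z, ∫⁻ z', ‖h z'‖ₑ ^ 2 * G (z - z') := by
          rw [← lintegral_add_left']
          · congr 1; ext z
            rw [lintegral_add_left]
            exact (hGm.comp (measurable_const.sub measurable_id)).const_mul _
          · simp_rw [hG1']
            exact hhm.pow_const 2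
      _ = (∫⁻ z, ∫⁻ z', ‖h z‖ₑ ^ 2 * G (z - z')) + ∫⁻ z', ∫⁻ z, ‖h z'‖ₑ ^ 2 * G (z - z') := by
          congr 1
          apply lintegral_lintegral_swap
          exact (hhm.pow_const 2).comp_snd.mul
            (hGm.comp (measurable_fst.sub measurable_snd)).aemeasurable
      _ = _ := by
          simp_rw [hG1', hG2']
          simp [two_mul]
  have step' := (ENNReal.mul_le_mul_iff_right (by simp) (by simp)).1 step
  refine le_trans ?_ step'
  refine (enorm_integral_le_lintegral_enorm _).trans ?_
  gcongr with z
  refine (enorm_integral_le_lintegral_enorm _).trans ?_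
  gcongr with z'
  have hcj : ‖conj (h z')‖ₑ = ‖h z'‖ₑ := by
    rw [← ofReal_norm, RCLike.norm_conj, ofReal_norm]
  rw [enorm_mul, enorm_mul, hcj, ← mul_assoc]
  gcongr
  exact hk z z'

open scoped FourierTransform in
theorem bessel (h : V → ℂ) (hh : Integrable h) : 
    ∫⁻ ξ, ‖𝓕 h ξ‖ₑ ^ 2 ≤ ∫⁻ x, ‖h x‖ₑ ^ 2 := by
  have hc : Continuous (𝓕 h) := by
    exact VectorFourier.fourierIntegral_continuous Real.continuous_fourierChar
      (by exact continuous_inner) hh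
  set b : ℕ → ℝ := fun k => 1 / ((k : ℝ) + 1)
  have hb : ∀ k, 0 < b k := fun k => by positivity
  have hlim : ∀ ξ : V, Filter.Tendsto (fun k => ENNReal.ofReal (rexp (-b k * ‖ξ‖ ^ 2)) * ‖𝓕 h ξ‖ₑ ^ 2) 
      Filter.atTop (nhds (‖𝓕 h ξ‖ₑ ^ 2)) := by
    intro ξ
    have h1 : Filter.Tendsto b Filter.atTop (nhds 0) := tendsto_one_div_add_atTop_nhds_zero_nat
    have h2 : Filter.Tendsto (fun k => ENNReal.ofReal (rexp (-b k * ‖ξ‖ ^ 2))) Filter.atTop (nhds 1) := by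
      have hcont : Continuous (fun b : ℝ => ENNReal.ofReal (rexp (-b * ‖ξ‖ ^ 2))) := by
        apply ENNReal.continuous_ofReal.comp
        fun_prop
      have := (hcont.tendsto 0).comp h1
      simpa [Function.comp_def] using this
    have := ENNReal.Tendsto.mul_const (b := ‖𝓕 h ξ‖ₑ ^ 2) h2 (Or.inl one_ne_zero)
    simpa using this
  calc _ = ∫⁻ ξ, Filter.liminf (fun k => ENNReal.ofReal (rexp (-b k * ‖ξ‖ ^ 2)) * ‖𝓕 h ξ‖ₑ ^ 2) Filter.atTop := by
        congr 1; ext ξ; exact (hlim ξ).liminf_eq.symm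
    _ ≤ Filter.liminf (fun k => ∫⁻ ξ, ENNReal.ofReal (rexp (-b k * ‖ξ‖ ^ 2)) * ‖𝓕 h ξ‖ₑ ^ 2) Filter.atTop := by
        apply lintegral_liminf_le
        intro k
        have h1 : Measurable (fun ξ : V => ENNReal.ofReal (rexp (-b k * ‖ξ‖ ^ 2))) := by
          apply ENNReal.measurable_ofReal.comp; fun_prop
        exact h1.mul (hc.measurable.enorm.pow_const 2)
    _ ≤ _ := by
        refine Filter.liminf_le_of_frequently_le' (Filter.Frequently.of_forall fun k => ?_)
        exact bessel_gauss h hh (hb k)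
end

section
set_option linter.unusedSectionVars false
variable {V : Type*} [NormedAddCommGroup V] [InnerProductSpace ℝ V] [FiniteDimensional ℝ V]
  [MeasurableSpace V] [BorelSpace V]

theorem norm_phase (a : ℝ) : ‖cexp (-2 * π * I * (a : ℝ))‖ = 1 := by
  rw [Complex.norm_exp]; simp

theorem gk_measurable' {α : Type*} [MeasurableSpace α] {f : α → ℝ} {g : α → V} (hf : Measurable f)
    (hg : Measurable g) : Measurable (fun a => gk V (f a) (g a)) := by
  unfold gk
  fun_prop

/-- fixed-time operator -/
noncomputable def TT (τ : ℝ) (g : V → ℂ) (x : V) : ℂ := ∫ y, g y * gk V τ (x - y)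

theorem gk_integrable (τ : ℝ) (g : V → ℂ) (hg : Integrable g) (x : V) : 
    Integrable (fun y => g y * gk V τ (x - y)) := by
  refine hg.mul_bdd (c := (1 + 4 * τ ^ 2) ^ (-(Module.finrank ℝ V : ℝ) / 4)) ?_ ?_
  · have : Measurable (fun y : V => gk V τ (x - y)) := 
      gk_measurable' measurable_const (measurable_const.sub measurable_id)
    exact this.aestronglyMeasurable
  · exact Filter.Eventually.of_forall fun y => gk_bound _ _

theorem TT_add (τ : ℝ) (g h : V → ℂ) (hg : Integrable g) (hh : Integrable h) (x : V) :
    TT τ (fun y => g y + h y) x = TT τ g x + TT τ h x := by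
  unfold TT
  simp_rw [add_mul]
  exact integral_add (gk_integrable τ g hg x) (gk_integrable τ h hh x)

theorem TT_linf (τ : ℝ) (g : V → ℂ) (x : V) :
    ‖TT τ g x‖ₑ ≤ ENNReal.ofReal ((1 + 4 * τ ^ 2) ^ (-(Module.finrank ℝ V : ℝ) / 4)) * ∫⁻ y, ‖g y‖ₑ := by
  unfold TT
  refine (enorm_integral_le_lintegral_enorm _).trans ?_
  rw [← lintegral_const_mul' _ _ (by simp)]
  gcongr with y
  rw [enorm_mul, mul_comm]
  gcongr
  rw [← ofReal_norm]
  exact ENNReal.ofReal_le_ofReal (gk_bound _ _)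

open scoped FourierTransform in
theorem TT_eq (τ : ℝ) (g : V → ℂ) (hg : Integrable g) (x : V) :
    TT τ g x = 𝓕 (fun ξ : V => (rexp (-π * ‖ξ‖ ^ 2) : ℂ) * cexp (-2 * π * I * ((τ * ‖ξ‖ ^ 2 : ℝ))) * 𝓕 g (-ξ)) x := by
  have hint : Integrable (fun q : V × V => (g q.1 * (rexp (-π * ‖q.2‖ ^ 2) : ℂ)) *
      cexp (-2 * π * I * ((⟪x - q.1, q.2⟫ + τ * ‖q.2‖ ^ 2 : ℝ)))) (volume.prod volume) := by
    refine (hg.mul_prod (integrable_gauss pi_pos)).mul_bdd (c := 1) ?_ ?_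
    · apply Continuous.aestronglyMeasurable
      fun_prop
    · refine Filter.Eventually.of_forall fun q => ?_
      exact (norm_phase _).le
  unfold TT
  calc _ = ∫ y, ∫ ξ : V, (g y * (rexp (-π * ‖ξ‖ ^ 2) : ℂ)) *
      cexp (-2 * π * I * ((⟪x - y, ξ⟫ + τ * ‖ξ‖ ^ 2 : ℝ))) := by
        congr 1; ext y
        rw [← gk_eq, ← integral_const_mul]
        congr 1; ext ξ; ring
    _ = ∫ ξ : V, ∫ y, (g y * (rexp (-π * ‖ξ‖ ^ 2) : ℂ)) *
      cexp (-2 * π * I * ((⟪x - y, ξ⟫ + τ * ‖ξ‖ ^ 2 : ℝ))) := integral_integral_swap hint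
    _ = _ := by
        rw [Real.fourier_eq']
        congr 1; ext ξ
        rw [Real.fourier_eq', smul_eq_mul, ← integral_const_mul, ← integral_const_mul]
        congr 1; ext y
        rw [smul_eq_mul]
        have : cexp (-2 * π * I * ((⟪x - y, ξ⟫ + τ * ‖ξ‖ ^ 2 : ℝ))) = 
          cexp (↑(-2 * π * ⟪ξ, x⟫) * I) * cexp (-2 * π * I * ((τ * ‖ξ‖ ^ 2 : ℝ))) * cexp (↑(-2 * π * ⟪y, -ξ⟫) * I) := by
          rw [← Complex.exp_add, ← Complex.exp_add]
          congr 1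
          rw [inner_sub_left, inner_neg_right, real_inner_comm x ξ]
          push_cast
          ring
        rw [this]
        ring

open scoped FourierTransform in
theorem TT_l2 (τ : ℝ) (g : V → ℂ) (hg : Integrable g) :
    ∫⁻ x, ‖TT τ g x‖ₑ ^ 2 ≤ ∫⁻ x, ‖g x‖ₑ ^ 2 := by
  have hc : Continuous (𝓕 g) := by
    exact VectorFourier.fourierIntegral_continuous Real.continuous_fourierChar
      (by exact continuous_inner) hg
  have hb : ∀ ξ, ‖𝓕 g ξ‖ ≤ ∫ x, ‖g x‖ := by
    intro ξ
    exact VectorFourier.norm_fourierIntegral_le_integral_norm _ _ _ _ _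
  simp_rw [TT_eq τ g hg]
  have hH : Integrable (fun ξ : V => (rexp (-π * ‖ξ‖ ^ 2) : ℂ) * cexp (-2 * π * I * ((τ * ‖ξ‖ ^ 2 : ℝ))) * 𝓕 g (-ξ)) := by
    refine Integrable.mul_bdd (c := ∫ x, ‖g x‖) (Integrable.mul_bdd (c := 1) (integrable_gauss pi_pos) ?_ ?_) ?_ ?_
    · apply Continuous.aestronglyMeasurable
      fun_prop
    · refine Filter.Eventually.of_forall fun q => ?_
      exact (norm_phase _).le
    · exact (hc.comp continuous_neg).aestronglyMeasurable
    · exact Filter.Eventually.of_forall fun q => hb _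
  calc _ ≤ ∫⁻ ξ : V, ‖(rexp (-π * ‖ξ‖ ^ 2) : ℂ) * cexp (-2 * π * I * ((τ * ‖ξ‖ ^ 2 : ℝ))) * 𝓕 g (-ξ)‖ₑ ^ 2 := bessel _ hH
    _ ≤ ∫⁻ ξ : V, ‖𝓕 g (-ξ)‖ₑ ^ 2 := by
      gcongr with ξ
      rw [← ofReal_norm, ← ofReal_norm]
      apply ENNReal.ofReal_le_ofReal
      rw [norm_mul, norm_mul, norm_phase, Complex.norm_real, Real.norm_of_nonneg (by positivity)]
      have h1 : rexp (-π * ‖ξ‖ ^ 2) ≤ 1 := by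
        rw [Real.exp_le_one_iff]
        have := pi_pos
        nlinarith [sq_nonneg ‖ξ‖]
      rw [mul_one]
      exact mul_le_of_le_one_left (norm_nonneg _) h1
    _ = ∫⁻ ξ : V, ‖𝓕 g ξ‖ₑ ^ 2 := lintegral_neg_eq_self (fun ξ : V => ‖𝓕 g ξ‖ₑ ^ 2)
    _ ≤ _ := bessel g hg

theorem TT_measurable (τ : ℝ) (g : V → ℂ) (hg : Measurable g) : Measurable (TT τ g) := by
  unfold TT
  have : StronglyMeasurable (fun q : V × V => g q.2 * gk V τ (q.1 - q.2)) := by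
    apply Measurable.stronglyMeasurable
    exact (hg.comp measurable_snd).mul (gk_measurable' measurable_const (measurable_fst.sub measurable_snd))
  exact this.integral_prod_right'.measurable
end


theorem lint_rpow_Ioc {a R : ℝ} (ha : -1 < a) (hR : 0 ≤ R) :
    ∫⁻ t in Set.Ioc 0 R, ENNReal.ofReal (t ^ a) = ENNReal.ofReal (R ^ (a + 1) / (a + 1)) := by
  have hi : IntegrableOn (fun t : ℝ => t ^ a) (Set.Ioc 0 R) := by
    have := intervalIntegral.intervalIntegrable_rpow' (a := 0) (b := R) ha
    rwa [intervalIntegrable_iff_integrableOn_Ioc_of_le hR] at this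
  rw [← ofReal_integral_eq_lintegral_ofReal hi, ← intervalIntegral.integral_of_le hR, integral_rpow (Or.inl ha),
    Real.zero_rpow (by linarith), sub_zero]
  filter_upwards [ae_restrict_mem measurableSet_Ioc] with t ht
  exact Real.rpow_nonneg ht.1.le _

theorem interp {α : Type*} [MeasurableSpace α] (μ : Measure α) [SFinite μ] (T : (α → ℂ) → α → ℂ)
    (A : ℝ) (hA : 0 < A) (p q : ℝ) (hp1 : 1 < p) (hp2 : p < 2) (hpq : p.HolderConjugate q)
    (hadd : ∀ g h : α → ℂ, Integrable g μ → Integrable h μ → ∀ x, T (fun y => g y + h y) x = T g x + T h x)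
    (hinf : ∀ g x, ‖T g x‖ₑ ≤ ENNReal.ofReal A * ∫⁻ y, ‖g y‖ₑ ∂μ)
    (hl2 : ∀ g, Integrable g μ → ∫⁻ x, ‖T g x‖ₑ ^ 2 ∂μ ≤ ∫⁻ x, ‖g x‖ₑ ^ 2 ∂μ)
    (hmeas : ∀ g, Measurable g → Measurable (T g))
    (g : α → ℂ) (hgm : Measurable g) (hg : Integrable g μ) (hN : ∫⁻ x, ‖g x‖ₑ ^ p ∂μ ≠ ⊤) :
    ∫⁻ x, ‖T g x‖ₑ ^ q ∂μ ≤ ENNReal.ofReal (q * (4 / (q - 2)) * 2 ^ (q - 2)) * 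
      ENNReal.ofReal A ^ (q - 2) * (∫⁻ x, ‖g x‖ₑ ^ p ∂μ) ^ (q - 1) := by
  have hmul : p + q = p * q := by
    have := hpq.inv_add_inv_eq_one
    have h1 := hpq.pos
    have h2 := hpq.symm.pos
    field_simp at this
    linarith
  have hq2 : 2 < q := by
    have h2 := hpq.symm.pos
    nlinarith
  have hq0 : 0 < q := by linarith
  by_cases hN0 : ∫⁻ x, ‖g x‖ₑ ^ p ∂μ = 0
  · have h0 : ∫⁻ x, ‖g x‖ₑ ∂μ = 0 := by
      rw [lintegral_eq_zero_iff (hgm.enorm.pow_const p)] at hN0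
      rw [lintegral_eq_zero_iff hgm.enorm]
      filter_upwards [hN0] with x hx
      simp only [Pi.zero_apply, ENNReal.rpow_eq_zero_iff] at hx ⊢
      rcases hx with h | h
      · exact h.1
      · linarith [h.2]
    have h1 : ∀ x, ‖T g x‖ₑ = 0 := by
      intro x
      have := hinf g x
      rw [h0, mul_zero] at this
      exact le_antisymm this bot_le
    simp [h1, hq0]
  set N : ℝ := (∫⁻ x, ‖g x‖ₑ ^ p ∂μ).toReal with hNdef
  have hNpos : 0 < N := ENNReal.toReal_pos hN0 hN
  have hNof : ∫⁻ x, ‖g x‖ₑ ^ p ∂μ = ENNReal.ofReal N := (ENNReal.ofReal_toReal hN).symm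
  set M : ℝ := 2 * A * N with hM
  have hMpos : 0 < M := by positivity
  have hgp : Measurable (fun x => ‖g x‖ ^ (p - 1)) := by fun_prop
  have henr : ∀ x, ‖g x‖ₑ ^ p = ENNReal.ofReal (‖g x‖ ^ p) := by
    intro x
    rw [← ofReal_norm, ENNReal.ofReal_rpow_of_nonneg (norm_nonneg _) (by linarith)]
  -- weak type bound
  have weak : ∀ l : ℝ, 0 < l → μ {x | l < ‖T g x‖} ≤ 
      ENNReal.ofReal (4 / l ^ 2) * ∫⁻ x, {x | l * ‖g x‖ ^ (p - 1) ≤ M}.indicator (fun x => ‖g x‖ₑ ^ 2) x ∂μ := by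
    intro l hl
    set S : Set α := {x | l * ‖g x‖ ^ (p - 1) ≤ M} with hS
    have hSm : MeasurableSet S := measurableSet_le (hgp.const_mul l) measurable_const
    have hi1 : Integrable (Sᶜ.indicator g) μ := hg.indicator hSm.compl
    have hi2 : Integrable (S.indicator g) μ := hg.indicator hSm
    have hsplit : ∀ x, T g x = T (Sᶜ.indicator g) x + T (S.indicator g) x := by
      intro x
      rw [← hadd _ _ hi1 hi2]
      congr 1
      ext y
      by_cases hy : y ∈ S <;> simp [hy]
    have hb1 : ∫⁻ y, ‖Sᶜ.indicator g y‖ₑ ∂μ ≤ ENNReal.ofReal (l / (2 * A)) := by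
      calc _ ≤ ∫⁻ y, ENNReal.ofReal (l / M) * ‖g y‖ₑ ^ p ∂μ := by
            gcongr with y
            by_cases hy : y ∈ S
            · simp [hy]
            · have hy' : M < l * ‖g y‖ ^ (p - 1) := by simpa [hS] using hy
              rw [Set.indicator_of_mem (by exact hy), henr, ← ENNReal.ofReal_mul (by positivity), ← ofReal_norm]
              apply ENNReal.ofReal_le_ofReal
              have hgpos : 0 < ‖g y‖ := by
                rcases (norm_nonneg (g y)).eq_or_lt with h | h
                · rw [← h, Real.zero_rpow (by linarith)] at hy'
                  linarith
                · exact h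
              have : ‖g y‖ ^ p = ‖g y‖ ^ (p - 1) * ‖g y‖ := by
                rw [← Real.rpow_add_one hgpos.ne']; congr 1; ring
              rw [this, ← mul_assoc]
              apply le_mul_of_one_le_left hgpos.le
              rw [div_mul_eq_mul_div, le_div_iff₀ hMpos]
              linarith
        _ = _ := by
          rw [lintegral_const_mul' _ _ (by simp), hNof, ← ENNReal.ofReal_mul (by positivity)]
          congr 1
          rw [hM]; field_simp
    have hb2 : ∀ x, ‖T (Sᶜ.indicator g) x‖ ≤ l / 2 := by
      intro x
      have := (hinf (Sᶜ.indicator g) x).trans (mul_le_mul_right hb1 _)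
      rw [← ofReal_norm, ← ENNReal.ofReal_mul hA.le, ENNReal.ofReal_le_ofReal_iff (by positivity)] at this
      refine this.trans (le_of_eq ?_)
      field_simp
    have hsub : {x | l < ‖T g x‖} ⊆ {x | ENNReal.ofReal (l / 2) ^ 2 ≤ ‖T (S.indicator g) x‖ₑ ^ 2} := by
      intro x hx
      simp only [Set.mem_ofPred_eq] at hx ⊢
      gcongr
      rw [← ofReal_norm]
      apply ENNReal.ofReal_le_ofReal
      have h1 := hb2 x
      have h2 : ‖T g x‖ ≤ _ := (hsplit x) ▸ norm_add_le (T (Sᶜ.indicator g) x) (T (S.indicator g) x)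
      linarith
    have hch : ENNReal.ofReal (l / 2) ^ 2 * μ {x | l < ‖T g x‖} ≤ ∫⁻ x, S.indicator (fun x => ‖g x‖ₑ ^ 2) x ∂μ := by
      calc _ ≤ ENNReal.ofReal (l / 2) ^ 2 * μ {x | ENNReal.ofReal (l / 2) ^ 2 ≤ ‖T (S.indicator g) x‖ₑ ^ 2} := by
            gcongr
        _ ≤ ∫⁻ x, ‖T (S.indicator g) x‖ₑ ^ 2 ∂μ := 
          mul_meas_ge_le_lintegral ((hmeas _ (hgm.indicator hSm)).enorm.pow_const 2) _
        _ ≤ ∫⁻ x, ‖S.indicator g x‖ₑ ^ 2 ∂μ := hl2 _ hi2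
        _ = _ := by
          congr 1; ext x
          by_cases hx : x ∈ S <;> simp [hx]
    calc μ {x | l < ‖T g x‖} = ENNReal.ofReal (4 / l ^ 2) * (ENNReal.ofReal (l / 2) ^ 2 * μ {x | l < ‖T g x‖}) := by
          rw [← mul_assoc, ← ENNReal.ofReal_pow (by positivity), ← ENNReal.ofReal_mul (by positivity)]
          have : 4 / l ^ 2 * (l / 2) ^ 2 = 1 := by field_simp; norm_num
          rw [this]; simp
      _ ≤ _ := by gcongr
  have lc := lintegral_rpow_eq_lintegral_meas_lt_mul μ (f := fun x => ‖T g x‖) 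
    (Filter.Eventually.of_forall fun x => norm_nonneg _) (hmeas g hgm).norm.aemeasurable hq0
  have hlhs : ∫⁻ x, ‖T g x‖ₑ ^ q ∂μ = ∫⁻ x, ENNReal.ofReal (‖T g x‖ ^ q) ∂μ := by
    congr 1; ext x
    rw [← ofReal_norm, ENNReal.ofReal_rpow_of_nonneg (norm_nonneg _) hq0.le]
  rw [hlhs, lc]
  set D : Set (ℝ × α) := {z | z.1 * ‖g z.2‖ ^ (p - 1) ≤ M} with hD
  have hDm : MeasurableSet D := 
    measurableSet_le (measurable_fst.mul (hgp.comp measurable_snd)) measurable_const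
  have hinner : ∀ x, ∫⁻ l in Set.Ioi (0:ℝ), D.indicator (fun z => ENNReal.ofReal (4 * z.1 ^ (q - 3)) * ‖g z.2‖ₑ ^ 2) (l, x)
      ≤ ENNReal.ofReal (4 / (q - 2) * M ^ (q - 2)) * ‖g x‖ₑ ^ p := by
    intro x
    rcases (norm_nonneg (g x)).eq_or_lt with h | h
    · have h0 : g x = 0 := norm_eq_zero.1 h.symm
      have : ∀ l : ℝ, D.indicator (fun z => ENNReal.ofReal (4 * z.1 ^ (q - 3)) * ‖g z.2‖ₑ ^ 2) (l, x) = 0 := by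
        intro l
        by_cases hl : (l, x) ∈ D <;> simp [hl, h0]
      simp only [this, lintegral_zero]
      exact bot_le
    set R := M / ‖g x‖ ^ (p - 1) with hR
    have hgx : 0 < ‖g x‖ ^ (p - 1) := by positivity
    have hRpos : 0 < R := by positivity
    calc _ ≤ ∫⁻ l in Set.Ioi (0:ℝ), (Set.Ioc 0 R).indicator (fun l => ENNReal.ofReal 4 * ‖g x‖ₑ ^ 2 * ENNReal.ofReal (l ^ (q - 3))) l := by
          apply setLIntegral_mono' measurableSet_Ioi
          intro l hl
          have hl : 0 < l := hl
          by_cases hlD : (l, x) ∈ D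
          · have hlR : l ∈ Set.Ioc 0 R := ⟨hl, by rw [hR, le_div_iff₀ hgx]; exact hlD⟩
            rw [Set.indicator_of_mem hlD, Set.indicator_of_mem hlR, ENNReal.ofReal_mul (by norm_num)]
            simp only
            apply le_of_eq; ring
          · rw [Set.indicator_of_notMem hlD]; exact bot_le
      _ ≤ ∫⁻ l, (Set.Ioc 0 R).indicator (fun l => ENNReal.ofReal 4 * ‖g x‖ₑ ^ 2 * ENNReal.ofReal (l ^ (q - 3))) l := 
          setLIntegral_le_lintegral _ _
      _ = ENNReal.ofReal 4 * ‖g x‖ₑ ^ 2 * ENNReal.ofReal (R ^ (q - 3 + 1) / (q - 3 + 1)) := by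
          rw [lintegral_indicator measurableSet_Ioc, lintegral_const_mul' _ _ (by finiteness), 
            lint_rpow_Ioc (by linarith) hRpos.le]
      _ = _ := by
          rw [henr, ← ofReal_norm, ← ENNReal.ofReal_pow (norm_nonneg _), ← ENNReal.ofReal_mul (by norm_num),
            ← ENNReal.ofReal_mul (by positivity), ← ENNReal.ofReal_mul (by
              have : 0 < q - 2 := by linarith
              positivity)]
          congr 1
          have e1 : q - 3 + 1 = q - 2 := by ring
          rw [e1, hR, Real.div_rpow hMpos.le hgx.le, ← Real.rpow_mul h.le]
          have e2 : (p - 1) * (q - 2) = 2 - p := by linarith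
          rw [e2, Real.rpow_sub h, Real.rpow_two]
          have : 0 < ‖g x‖ ^ p := by positivity
          have : 0 < q - 2 := by linarith
          field_simp
  calc _ ≤ ENNReal.ofReal q * ∫⁻ l in Set.Ioi (0:ℝ), ∫⁻ x, D.indicator (fun z => ENNReal.ofReal (4 * z.1 ^ (q - 3)) * ‖g z.2‖ₑ ^ 2) (l, x) ∂μ := by
        refine mul_le_mul_right ?_ _
        apply setLIntegral_mono' measurableSet_Ioi
        intro l hl
        have hl : 0 < l := hl
        refine (mul_le_mul_left (weak l hl) _).trans ?_
        rw [mul_right_comm, ← ENNReal.ofReal_mul (by positivity), ← lintegral_const_mul' _ _ (by simp)]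
        apply le_of_eq
        congr 1; ext x
        have e : 4 / l ^ 2 * l ^ (q - 1) = 4 * l ^ (q - 3) := by
          have : q - 3 = (q - 1) - 2 := by ring
          rw [this, Real.rpow_sub hl (q - 1) 2, Real.rpow_two]
          field_simp
        rw [e]
        by_cases hx : l * ‖g x‖ ^ (p - 1) ≤ M
        · rw [Set.indicator_of_mem (by exact hx), Set.indicator_of_mem (by exact hx)]
        · rw [Set.indicator_of_notMem (by exact hx), Set.indicator_of_notMem (by exact hx), mul_zero]
    _ = ENNReal.ofReal q * ∫⁻ x, ∫⁻ l in Set.Ioi (0:ℝ), D.indicator (fun z => ENNReal.ofReal (4 * z.1 ^ (q - 3)) * ‖g z.2‖ₑ ^ 2) (l, x) ∂volume ∂μ := by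
        congr 1
        apply lintegral_lintegral_swap
        apply Measurable.aemeasurable
        have h1 : Measurable (fun z : ℝ × α => ENNReal.ofReal (4 * z.1 ^ (q - 3)) * ‖g z.2‖ₑ ^ 2) := by
          have : Measurable (fun z : ℝ × α => ENNReal.ofReal (4 * z.1 ^ (q - 3))) := by fun_prop
          exact this.mul ((hgm.comp measurable_snd).enorm.pow_const 2)
        exact h1.indicator hDm
    _ ≤ ENNReal.ofReal q * ∫⁻ x, ENNReal.ofReal (4 / (q - 2) * M ^ (q - 2)) * ‖g x‖ₑ ^ p ∂μ := by
        gcongr with x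
        exact hinner x
    _ = _ := by
        have : 0 < q - 2 := by linarith
        rw [lintegral_const_mul' _ _ (by simp), hNof, ENNReal.ofReal_rpow_of_pos hA, ENNReal.ofReal_rpow_of_pos hNpos,
          ← ENNReal.ofReal_mul (by positivity), ← ENNReal.ofReal_mul (by positivity), ← ENNReal.ofReal_mul (by positivity),
          ← ENNReal.ofReal_mul (by positivity)]
        congr 1
        have e : q - 1 = (q - 2) + 1 := by ring
        rw [hM, Real.mul_rpow (by positivity) (by positivity), Real.mul_rpow (by positivity) (by positivity), e, 
          Real.rpow_add_one hNpos.ne']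
        ring


theorem lint_abs (φ : ℝ → ENNReal) : ∫⁻ u : ℝ, φ |u| = 2 * ∫⁻ u in Set.Ioi (0:ℝ), φ u := by
  rw [← lintegral_add_compl _ (measurableSet_Ioi (a := (0:ℝ))), Set.compl_Ioi, two_mul]
  congr 1
  · apply setLIntegral_congr_fun measurableSet_Ioi
    intro u hu
    simp only
    rw [abs_of_pos hu]
  · rw [← setLIntegral_congr (Iio_ae_eq_Iic (a := (0:ℝ)) (μ := volume))]
    have := (Measure.measurePreserving_neg (volume : Measure ℝ)).setLIntegral_comp_preimage_emb
      (MeasurableEquiv.neg ℝ).measurableEmbedding (fun u => φ |u|) (Set.Iio 0)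
    rw [← this]
    have e : (Neg.neg ⁻¹' Set.Iio (0:ℝ)) = Set.Ioi 0 := by ext; simp
    rw [e]
    apply setLIntegral_congr_fun measurableSet_Ioi
    intro u hu
    simp only
    rw [abs_neg, abs_of_pos hu]

theorem lint_abs_le {a r : ℝ} (ha : -1 < a) (hr : 0 < r) :
    ∫⁻ u : ℝ, (Set.Iic r).indicator (fun x => ENNReal.ofReal (x ^ a)) |u| = ENNReal.ofReal (2 * (r ^ (a + 1) / (a + 1))) := by
  rw [lint_abs, lintegral_indicator measurableSet_Iic, Measure.restrict_restrict measurableSet_Iic, Set.inter_comm,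
    Set.Ioi_inter_Iic, lint_rpow_Ioc ha hr.le, ENNReal.ofReal_mul (by norm_num)]
  simp

theorem lint_abs_gt {r : ℝ} (hr : 0 < r) :
    ∫⁻ u : ℝ, (Set.Ioi r).indicator (fun x => ENNReal.ofReal (x ^ (-2 : ℝ))) |u| = ENNReal.ofReal (2 / r) := by
  rw [lint_abs, lintegral_indicator measurableSet_Ioi, Measure.restrict_restrict measurableSet_Ioi,
    Set.Ioi_inter_Ioi, max_eq_left hr.le, ← ofReal_integral_eq_lintegral_ofReal (integrableOn_Ioi_rpow_of_lt (by norm_num) hr),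
    integral_Ioi_rpow_of_lt (by norm_num) hr, div_eq_mul_inv 2 r, ENNReal.ofReal_mul (by norm_num)]
  · norm_num
    rw [Real.rpow_neg_one]
  · filter_upwards [ae_restrict_mem measurableSet_Ioi] with t ht
    exact Real.rpow_nonneg (hr.trans ht).le _

theorem hls_pt (p q : ℝ) (hp1 : 1 < p) (hp2 : p < 2) (hpq : p.HolderConjugate q)
    (F : ℝ → ENNReal) (hF : Measurable F) (hN0 : ∫⁻ t, F t ^ p ≠ 0) (hN : ∫⁻ t, F t ^ p ≠ ⊤) (t : ℝ) :
    F t * ∫⁻ s, min (F s) (F t) * ENNReal.ofReal (|t - s| ^ (-(2 / q))) ≤ 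
      ENNReal.ofReal (2 / (1 - 2 / q) + 2 ^ (1 / q)) * (∫⁻ t, F t ^ p) ^ (2 / p - 1) * F t ^ p := by
  have hmul : p + q = p * q := by
    have := hpq.inv_add_inv_eq_one
    have h1 := hpq.pos
    have h2 := hpq.symm.pos
    field_simp at this
    linarith
  have hp0 : 0 < p := by linarith
  have hq2 : 2 < q := by
    have h2 := hpq.symm.pos
    nlinarith
  have hq0 : 0 < q := by linarith
  have hγ : 2 / q < 1 := by rw [div_lt_one hq0]; exact hq2
  have hC : 0 < 2 / (1 - 2 / q) + 2 ^ (1 / q) := by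
    have : 0 < 1 - 2 / q := by linarith
    positivity
  by_cases ha0 : F t = 0
  · simp [ha0]
  by_cases haT : F t = ⊤
  · rw [haT, ENNReal.top_rpow_of_pos hp0, ENNReal.mul_top]
    · exact le_top
    · apply mul_ne_zero
      · simpa using hC
      · simp [ENNReal.rpow_eq_zero_iff, hN0, hN]
  set N : ℝ := (∫⁻ t, F t ^ p).toReal with hNdef
  have hNpos : 0 < N := ENNReal.toReal_pos hN0 hN
  have hNof : ∫⁻ t, F t ^ p = ENNReal.ofReal N := (ENNReal.ofReal_toReal hN).symm
  set a : ℝ := (F t).toReal with hadef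
  have hapos : 0 < a := ENNReal.toReal_pos ha0 haT
  have haof : F t = ENNReal.ofReal a := (ENNReal.ofReal_toReal haT).symm
  set r : ℝ := N * a ^ (-p) with hr
  have hrpos : 0 < r := by positivity
  set k1 : ℝ → ENNReal := fun u => (Set.Iic r).indicator (fun x => ENNReal.ofReal (x ^ (-(2 / q)))) |u| with hk1
  set k2 : ℝ → ENNReal := fun u => (Set.Ioi r).indicator (fun x => ENNReal.ofReal (x ^ (-(2 / q)))) |u| with hk2
  have hk1m : Measurable k1 := by
    have : Measurable ((Set.Iic r).indicator (fun x => ENNReal.ofReal (x ^ (-(2 / q))))) := 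
      Measurable.indicator (by fun_prop) measurableSet_Iic
    exact this.comp measurable_norm
  have hk2m : Measurable k2 := by
    have : Measurable ((Set.Ioi r).indicator (fun x => ENNReal.ofReal (x ^ (-(2 / q))))) := 
      Measurable.indicator (by fun_prop) measurableSet_Ioi
    exact this.comp measurable_norm
  have hk1i : ∫⁻ s, k1 (t - s) = ENNReal.ofReal (2 * (r ^ (1 - 2 / q) / (1 - 2 / q))) := by
    rw [lintegral_sub_left_eq_self k1 t, hk1, lint_abs_le (by linarith) hrpos]
    congr 3 <;> ring_nf
  have hk2i : ∫⁻ s, k2 (t - s) ^ q = ENNReal.ofReal (2 / r) := by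
    rw [lintegral_sub_left_eq_self (fun u => k2 u ^ q) t, ← lint_abs_gt hrpos]
    congr 1; ext u
    by_cases hu : |u| ∈ Set.Ioi r
    · simp only [hk2, Set.indicator_of_mem hu]
      have : 0 < |u| := hrpos.trans hu
      rw [ENNReal.ofReal_rpow_of_pos (by positivity), ← Real.rpow_mul this.le]
      congr 2; field_simp
    · simp only [hk2, Set.indicator_of_notMem hu]
      simp [hq0]
  have hold : ∫⁻ s, F s * k2 (t - s) ≤ ENNReal.ofReal N ^ (1 / p) * ENNReal.ofReal (2 / r) ^ (1 / q) := by
    have := ENNReal.lintegral_mul_le_Lp_mul_Lq volume hpq hF.aemeasurable 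
      (hk2m.comp (measurable_const.sub measurable_id) : Measurable (fun s => k2 (t - s))).aemeasurable
    simp only [Pi.mul_apply, Function.comp] at this
    rw [hNof] at this
    refine this.trans (le_of_eq ?_)
    rw [← hk2i]
  calc _ ≤ F t * ∫⁻ s, (F t * k1 (t - s) + F s * k2 (t - s)) := by
        gcongr with s
        by_cases hs : |t - s| ≤ r
        · have : k1 (t - s) = ENNReal.ofReal (|t - s| ^ (-(2 / q))) := Set.indicator_of_mem (by exact hs) _
          rw [this]
          refine le_trans ?_ le_self_add
          gcongr
          exact min_le_right _ _
        · have : k2 (t - s) = ENNReal.ofReal (|t - s| ^ (-(2 / q))) := Set.indicator_of_mem (by exact not_le.1 hs) _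
          rw [this]
          refine le_trans ?_ le_add_self
          gcongr
          exact min_le_left _ _
    _ = F t * (F t * ENNReal.ofReal (2 * (r ^ (1 - 2 / q) / (1 - 2 / q))) + ∫⁻ s, F s * k2 (t - s)) := by
        have hm : Measurable (fun s => k1 (t - s)) := hk1m.comp (measurable_const.sub measurable_id)
        rw [lintegral_add_left (hm.const_mul _), lintegral_const_mul _ hm, hk1i]
    _ ≤ F t * (F t * ENNReal.ofReal (2 * (r ^ (1 - 2 / q) / (1 - 2 / q))) + ENNReal.ofReal N ^ (1 / p) * ENNReal.ofReal (2 / r) ^ (1 / q)) := by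
        gcongr
    _ = _ := by
        have h1 : 0 < 1 - 2 / q := by linarith
        rw [haof, hNof, ENNReal.ofReal_rpow_of_pos hNpos, ENNReal.ofReal_rpow_of_pos hNpos, 
          ENNReal.ofReal_rpow_of_pos hapos, ENNReal.ofReal_rpow_of_pos (by positivity), 
          ← ENNReal.ofReal_mul (by positivity), ← ENNReal.ofReal_mul (by positivity), ← ENNReal.ofReal_add (by positivity) (by positivity),
          ← ENNReal.ofReal_mul (by positivity), ← ENNReal.ofReal_mul (by positivity), ← ENNReal.ofReal_mul (by positivity)]
        congr 1
        have hiq : 1 / q = 1 - 1 / p := by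
          field_simp; linarith
        have e0 : 1 - 2 / q = 2 / p - 1 := by
          have : 2 / q = 2 * (1 / q) := by ring
          rw [this, hiq]; ring
        have e1 : r ^ (1 - 2 / q) = N ^ (2 / p - 1) * a ^ (p - 2) := by
          rw [e0, hr, Real.mul_rpow (by positivity) (by positivity), ← Real.rpow_mul hapos.le]
          congr 2
          field_simp; ring
        have e2 : (2 / r) ^ (1 / q) = 2 ^ (1 / q) * (N ^ (1 / p - 1) * a ^ (p - 1)) := by
          rw [Real.div_rpow (by norm_num) hrpos.le, div_eq_mul_inv, ← Real.rpow_neg hrpos.le, hr, 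
            Real.mul_rpow (by positivity) (by positivity), ← Real.rpow_mul hapos.le]
          congr 3
          · rw [hiq]; ring
          · rw [hiq]; field_simp
        have e3 : N ^ (1 / p) * N ^ (1 / p - 1) = N ^ (2 / p - 1) := by
          rw [← Real.rpow_add hNpos]; congr 1; ring
        have e4 : a ^ p = a * a * a ^ (p - 2) := by
          rw [Real.rpow_sub hapos, Real.rpow_two]; field_simp
        have e5 : a ^ (p - 1) = a * a ^ (p - 2) := by
          rw [Real.rpow_sub hapos, Real.rpow_sub hapos, Real.rpow_two, Real.rpow_one]; field_simp
        rw [e1, e2, e4, e5, ← e3]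
        ring

theorem hls (p q : ℝ) (hp1 : 1 < p) (hp2 : p < 2) (hpq : p.HolderConjugate q)
    (F : ℝ → ENNReal) (hF : Measurable F) (hN : ∫⁻ t, F t ^ p ≠ ⊤) :
    ∫⁻ t, ∫⁻ s, F t * F s * ENNReal.ofReal (|t - s| ^ (-(2 / q))) ≤ 
      2 * ENNReal.ofReal (2 / (1 - 2 / q) + 2 ^ (1 / q)) * (∫⁻ t, F t ^ p) ^ (2 / p) := by
  have hp0 : 0 < p := by linarith
  by_cases hN0 : ∫⁻ t, F t ^ p = 0
  · have h0 : ∀ᵐ t, F t = 0 := by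
      rw [lintegral_eq_zero_iff (hF.pow_const p)] at hN0
      filter_upwards [hN0] with x hx
      simp only [Pi.zero_apply, ENNReal.rpow_eq_zero_iff] at hx
      rcases hx with h | h
      · exact h.1
      · linarith [h.2]
    have : ∫⁻ t, ∫⁻ s, F t * F s * ENNReal.ofReal (|t - s| ^ (-(2 / q))) = 0 := by
      rw [lintegral_eq_zero_iff']
      · filter_upwards [h0] with t ht
        simp [ht]
      · apply Measurable.aemeasurable
        apply Measurable.lintegral_prod_right'  (f := fun z : ℝ × ℝ => F z.1 * F z.2 * ENNReal.ofReal (|z.1 - z.2| ^ (-(2 / q))))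
        exact ((hF.comp measurable_fst).mul (hF.comp measurable_snd)).mul (by fun_prop)
    rw [this]; exact bot_le
  set k : ℝ → ENNReal := fun u => ENNReal.ofReal (|u| ^ (-(2 / q))) with hk
  have hkm : Measurable (fun z : ℝ × ℝ => k (z.1 - z.2)) := by
    simp only [hk]; fun_prop
  have hm1 : Measurable (fun z : ℝ × ℝ => F z.1 * (min (F z.2) (F z.1) * k (z.1 - z.2))) := 
    (hF.comp measurable_fst).mul (((hF.comp measurable_snd).min (hF.comp measurable_fst)).mul hkm)
  have hm2 : Measurable (fun z : ℝ × ℝ => F z.2 * (min (F z.1) (F z.2) * k (z.2 - z.1))) := 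
    hm1.comp measurable_swap
  calc _ ≤ ∫⁻ t, ∫⁻ s, (F t * (min (F s) (F t) * k (t - s)) + F s * (min (F t) (F s) * k (s - t))) := by
        gcongr with t s
        have : k (s - t) = k (t - s) := by simp only [hk]; rw [abs_sub_comm]
        rw [this]
        rcases le_total (F s) (F t) with h | h
        · rw [min_eq_left h, mul_assoc]; exact le_self_add
        · rw [min_eq_left h]; refine le_trans (le_of_eq ?_) le_add_self
          simp only [hk]; ring
    _ = (∫⁻ t, ∫⁻ s, F t * (min (F s) (F t) * k (t - s))) + ∫⁻ t, ∫⁻ s, F s * (min (F t) (F s) * k (s - t)) := by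
        rw [← lintegral_add_left hm1.lintegral_prod_right']
        congr 1; ext t
        rw [lintegral_add_left]
        exact hm1.comp (measurable_const.prodMk measurable_id)
    _ = 2 * ∫⁻ t, ∫⁻ s, F t * (min (F s) (F t) * k (t - s)) := by
        rw [two_mul]
        congr 1
        exact lintegral_lintegral_swap hm2.aemeasurable
    _ ≤ 2 * ∫⁻ t, ENNReal.ofReal (2 / (1 - 2 / q) + 2 ^ (1 / q)) * (∫⁻ t, F t ^ p) ^ (2 / p - 1) * F t ^ p := by
        gcongr with t
        refine le_trans (le_of_eq ?_) (hls_pt p q hp1 hp2 hpq F hF hN0 hN t)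
        rw [lintegral_const_mul]
        have : Measurable (fun s => ((t, s) : ℝ × ℝ)) := measurable_const.prodMk measurable_id
        have h3 : Measurable (fun z : ℝ × ℝ => (min (F z.2) (F z.1) * k (z.1 - z.2))) := 
          (((hF.comp measurable_snd).min (hF.comp measurable_fst)).mul hkm)
        exact h3.comp this
    _ = _ := by
        rw [lintegral_const_mul _ (hF.pow_const p), mul_assoc, mul_assoc]
        congr 2
        have : 2 / p = (2 / p - 1) + 1 := by ring
        conv_rhs => rw [this]
        rw [ENNReal.rpow_add _ _ hN0 hN, ENNReal.rpow_one]

section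
variable {V : Type*} [NormedAddCommGroup V] [InnerProductSpace ℝ V] [FiniteDimensional ℝ V]
  [MeasurableSpace V] [BorelSpace V]

theorem kernel_cmp (d p q τ : ℝ) (hp1 : 1 < p) (hpq : p.HolderConjugate q)
    (hp : p * (d + 4) ≤ 2 * d + 4) (hτ : τ ≠ 0) :
    ((1 + 4 * τ ^ 2) ^ (-d / 4)) ^ ((q - 2) / q) ≤ |τ| ^ (-(2 / q)) := by
  have hmul : p + q = p * q := by
    have := hpq.inv_add_inv_eq_one
    have h1 := hpq.pos
    have h2 := hpq.symm.pos
    field_simp at this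
    linarith
  have hq0 : 0 < q := hpq.symm.pos
  have h4 : 4 ≤ d * (q - 2) := by
    have : (p - 1) * (d * (q - 2)) = d * (2 - p) := by
      have : (p - 1) * (q - 2) = 2 - p := by linarith
      rw [← this]; ring
    nlinarith
  have hτ2 : 0 < τ ^ 2 := by positivity
  rw [← Real.rpow_mul (by positivity)]
  calc _ ≤ (1 + 4 * τ ^ 2) ^ (-(1 / q)) := by
        apply Real.rpow_le_rpow_of_exponent_le (by linarith)
        rw [div_mul_div_comm, ← neg_div, div_le_div_iff₀ (by positivity) hq0]
        nlinarith
    _ ≤ (τ ^ 2) ^ (-(1 / q)) := by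
        apply Real.rpow_le_rpow_of_nonpos hτ2 (by linarith)
        have : 0 < 1 / q := by positivity
        linarith
    _ = _ := by
        rw [← sq_abs, ← Real.rpow_natCast, ← Real.rpow_mul (abs_nonneg _)]
        congr 1; push_cast; ring

theorem fixed_time (p q : ℝ) (hp1 : 1 < p) (hp2 : p < 2) (hpq : p.HolderConjugate q)
    (hp : p * ((Module.finrank ℝ V : ℝ) + 4) ≤ 2 * (Module.finrank ℝ V : ℝ) + 4) (τ : ℝ) (hτ : τ ≠ 0)
    (g h : V → ℂ) (hg : Measurable g) (hh : Measurable h) (hgi : Integrable g) 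
    (hN : ∫⁻ x, ‖g x‖ₑ ^ p ≠ ⊤) :
    ∫⁻ x, ‖h x‖ₑ * ‖TT τ g x‖ₑ ≤ ENNReal.ofReal (q * (4 / (q - 2)) * 2 ^ (q - 2)) ^ (1 / q) * 
      ((∫⁻ x, ‖h x‖ₑ ^ p) ^ (1 / p) * (∫⁻ x, ‖g x‖ₑ ^ p) ^ (1 / p) * ENNReal.ofReal (|τ| ^ (-(2 / q)))) := by
  have hmul : p + q = p * q := by
    have := hpq.inv_add_inv_eq_one
    have h1 := hpq.pos
    have h2 := hpq.symm.pos
    field_simp at this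
    linarith
  have hp0 : 0 < p := hpq.pos
  have hq0 : 0 < q := hpq.symm.pos
  have hA : 0 < (1 + 4 * τ ^ 2) ^ (-(Module.finrank ℝ V : ℝ) / 4) := by positivity
  have h1 := interp volume (TT (V := V) τ) _ hA p q hp1 hp2 hpq (TT_add τ) (TT_linf τ) (TT_l2 τ)
    (TT_measurable τ) g hg hgi hN
  have h2 := ENNReal.lintegral_mul_le_Lp_mul_Lq (volume : Measure V) hpq hh.enorm.aemeasurable 
    (TT_measurable τ g hg).enorm.aemeasurable
  simp only [Pi.mul_apply] at h2
  refine h2.trans ?_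
  have h3 := ENNReal.rpow_le_rpow h1 (by positivity : 0 ≤ 1 / q)
  rw [ENNReal.mul_rpow_of_nonneg _ _ (by positivity), ENNReal.mul_rpow_of_nonneg _ _ (by positivity), 
    ← ENNReal.rpow_mul, ← ENNReal.rpow_mul] at h3
  have e1 : (q - 1) * (1 / q) = 1 / p := by
    field_simp; linarith
  have e2 : (q - 2) * (1 / q) = (q - 2) / q := by ring
  rw [e1, e2, ENNReal.ofReal_rpow_of_pos hA] at h3
  have h4 := ENNReal.ofReal_le_ofReal (kernel_cmp _ p q τ hp1 hpq hp hτ)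
  calc _ ≤ _ := mul_le_mul_right (h3.trans (mul_le_mul_left (mul_le_mul_right h4 _) _)) _
    _ = _ := by ring

open scoped ComplexConjugate in
theorem strichartz (p q : ℝ) (hp1 : 1 < p) (hp2 : p < 2) (hpq : p.HolderConjugate q)
    (hp : p * ((Module.finrank ℝ V : ℝ) + 4) ≤ 2 * (Module.finrank ℝ V : ℝ) + 4)
    (f : V × ℝ → ℂ) (hfm : Measurable f) (hf : Integrable f) (hN : ∫⁻ z, ‖f z‖ₑ ^ p ≠ ⊤) :
    ∫⁻ ξ : V, ENNReal.ofReal (rexp (-π * ‖ξ‖ ^ 2)) * 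
      ‖∫ z, f z * cexp (-2 * π * I * ((⟪z.1, ξ⟫ + z.2 * ‖ξ‖ ^ 2 : ℝ)))‖ₑ ^ 2 ≤ 
    ENNReal.ofReal (q * (4 / (q - 2)) * 2 ^ (q - 2)) ^ (1 / q) * 
     (2 * ENNReal.ofReal (2 / (1 - 2 / q) + 2 ^ (1 / q)) * (∫⁻ z, ‖f z‖ₑ ^ p) ^ (2 / p)) := by
  have hp0 : 0 < p := hpq.pos
  have hvol : (volume : Measure (V × ℝ)) = (volume : Measure V).prod volume := Measure.volume_eq_prod _ _
  set C0 := ENNReal.ofReal (q * (4 / (q - 2)) * 2 ^ (q - 2)) ^ (1 / q) with hC0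
  have hC0T : C0 ≠ ⊤ := by
    refine ENNReal.rpow_ne_top_of_nonneg ?_ (by simp)
    have := hpq.symm.pos
    positivity
  set F : ℝ → ENNReal := fun t => (∫⁻ x, ‖f (x, t)‖ₑ ^ p) ^ (1 / p) with hF
  have hFm : Measurable F := by
    apply Measurable.pow_const
    exact Measurable.lintegral_prod_left' (f := fun z : V × ℝ => ‖f z‖ₑ ^ p) (hfm.enorm.pow_const p)
  have hFp : ∀ t, F t ^ p = ∫⁻ x, ‖f (x, t)‖ₑ ^ p := by
    intro t
    simp only [hF]
    rw [← ENNReal.rpow_mul, one_div, inv_mul_cancel₀ hp0.ne', ENNReal.rpow_one]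
  have hFN : ∫⁻ t, F t ^ p = ∫⁻ z, ‖f z‖ₑ ^ p := by
    simp_rw [hFp]
    rw [hvol, lintegral_prod_symm' _ (hfm.enorm.pow_const p)]
  have hae1 : ∀ᵐ s : ℝ, Integrable (fun x => f (x, s)) := by
    rw [hvol] at hf
    exact hf.prod_left_ae
  have hae2 : ∀ᵐ s : ℝ, ∫⁻ x, ‖f (x, s)‖ₑ ^ p ≠ ⊤ := by
    have h1 : ∫⁻ s : ℝ, ∫⁻ x, ‖f (x, s)‖ₑ ^ p ≠ ⊤ := by
      simp_rw [← hFp]; rw [hFN]; exact hN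
    have := ae_lt_top (Measurable.lintegral_prod_left' (f := fun z : V × ℝ => ‖f z‖ₑ ^ p) (hfm.enorm.pow_const p)) h1
    filter_upwards [this] with s hs using hs.ne
  set U : V → ℝ → ℝ → ENNReal := fun x t s => ‖TT (t - s) (fun y => conj (f (y, s))) x‖ₑ with hU
  have hUm : Measurable (fun z : (V × ℝ) × ℝ => U z.1.1 z.1.2 z.2) := by
    simp only [hU]
    apply Measurable.enorm
    unfold TT
    have : StronglyMeasurable (fun w : ((V × ℝ) × ℝ) × V => 
        conj (f (w.2, w.1.2)) * gk V (w.1.1.2 - w.1.2) (w.1.1.1 - w.2)) := by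
      apply Measurable.stronglyMeasurable
      refine Measurable.mul ?_ (gk_measurable' ?_ ?_)
      · exact Complex.continuous_conj.measurable.comp (hfm.comp (by fun_prop))
      · fun_prop
      · exact Measurable.sub (by fun_prop) measurable_snd
    exact this.integral_prod_right'.measurable
  have hfc : Integrable (fun z => conj (f z)) := 
    ⟨Complex.continuous_conj.comp_aestronglyMeasurable hf.1, by
      refine hf.2.mono ?_
      simp⟩
  rw [quad_bound (fun ξ : V => rexp (-π * ‖ξ‖ ^ 2)) (fun _ => by positivity) (integrable_gauss pi_pos) f hf
    (fun ξ z => cexp (-2 * π * I * ((⟪z.1, ξ⟫ + z.2 * ‖ξ‖ ^ 2 : ℝ)))) (by 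
      apply Continuous.measurable
      unfold Function.uncurry
      fun_prop) (fun ξ z => (norm_phase _).le)]
  have hker : ∀ z z' : V × ℝ, ∫ ξ : V, (rexp (-π * ‖ξ‖ ^ 2) : ℂ) * (cexp (-2 * π * I * ((⟪z.1, ξ⟫ + z.2 * ‖ξ‖ ^ 2 : ℝ))) * 
      conj (cexp (-2 * π * I * ((⟪z'.1, ξ⟫ + z'.2 * ‖ξ‖ ^ 2 : ℝ))))) = gk V (z.2 - z'.2) (z.1 - z'.1) := by
    intro z z'
    rw [← gk_eq]
    congr 1; ext ξ
    rw [← Complex.exp_conj, ← Complex.exp_add]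
    congr 2
    simp [inner_sub_left, Complex.conj_ofNat]
    ring
  simp_rw [hker]
  have hpt : ∀ z : V × ℝ, ‖∫ z', f z * (conj (f z') * gk V (z.2 - z'.2) (z.1 - z'.1))‖ₑ ≤ 
      ‖f z‖ₑ * ∫⁻ s, U z.1 z.2 s := by
    intro z
    rw [integral_const_mul, enorm_mul]
    gcongr
    rw [hvol, integral_prod_symm]
    · exact enorm_integral_le_lintegral_enorm _
    · rw [← hvol]
      -- bounded kernel
      refine hfc.mul_bdd (c := 1) ?_ ?_
      · have : Measurable (fun z' : V × ℝ => gk V (z.2 - z'.2) (z.1 - z'.1)) := 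
          gk_measurable' (by fun_prop) (measurable_const.sub measurable_fst)
        exact this.aestronglyMeasurable
      · refine Filter.Eventually.of_forall fun z' => (gk_bound _ _).trans ?_
        apply Real.rpow_le_one_of_one_le_of_nonpos
        · nlinarith [sq_nonneg (z.2 - z'.2)]
        · have : (0 : ℝ) ≤ (Module.finrank ℝ V : ℝ) := by positivity
          linarith
  calc _ ≤ ∫⁻ z : V × ℝ, ‖f z‖ₑ * ∫⁻ s, U z.1 z.2 s := by
        refine (enorm_integral_le_lintegral_enorm _).trans ?_
        gcongr with z
        exact hpt z
    _ = ∫⁻ t : ℝ, ∫⁻ x : V, ‖f (x, t)‖ₑ * ∫⁻ s, U x t s := by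
        rw [hvol, lintegral_prod_symm']
        exact hfm.enorm.mul hUm.lintegral_prod_right'
    _ = ∫⁻ t : ℝ, ∫⁻ s : ℝ, ∫⁻ x : V, ‖f (x, t)‖ₑ * U x t s := by
        congr 1; ext t
        have hm : Measurable (fun w : V × ℝ => U w.1 t w.2) := 
          hUm.comp (f := fun w : V × ℝ => ((w.1, t), w.2)) (by fun_prop)
        have hft : Measurable (fun x => f (x, t)) := hfm.comp (by fun_prop)
        rw [← lintegral_lintegral_swap]
        · congr 1; ext x
          rw [lintegral_const_mul]
          exact hm.comp (f := fun s : ℝ => (x, s)) (by fun_prop)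
        · exact ((hft.enorm.comp measurable_fst).mul hm).aemeasurable
    _ ≤ ∫⁻ t : ℝ, ∫⁻ s : ℝ, C0 * (F t * F s * ENNReal.ofReal (|t - s| ^ (-(2 / q)))) := by
        refine lintegral_mono fun t => ?_
        apply lintegral_mono_ae
        have hne : ∀ᵐ s : ℝ, s ≠ t := by
          exact Measure.ae_ne volume t
        filter_upwards [hae1, hae2, hne] with s h1 h2 h3
        have hg1 : Measurable (fun x => conj (f (x, s))) := 
          Complex.continuous_conj.measurable.comp (hfm.comp (by fun_prop))
        have hg2 : Integrable (fun x => conj (f (x, s))) := 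
          ⟨hg1.aestronglyMeasurable, by
            refine h1.2.mono ?_
            simp⟩
        have hcj : ∀ x, ‖conj (f (x, s))‖ₑ = ‖f (x, s)‖ₑ := by
          intro x
          rw [← ofReal_norm, RCLike.norm_conj, ofReal_norm]
        have := fixed_time p q hp1 hp2 hpq hp (t - s) (sub_ne_zero.2 h3.symm) (fun x => conj (f (x, s)))
          (fun x => f (x, t)) hg1 (hfm.comp (by fun_prop)) hg2 (by simp_rw [hcj]; exact h2)
        simp_rw [hcj] at this
        exact this
    _ = C0 * ∫⁻ t : ℝ, ∫⁻ s : ℝ, (F t * F s * ENNReal.ofReal (|t - s| ^ (-(2 / q)))) := by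
        rw [← lintegral_const_mul' _ _ hC0T]
        congr 1; ext t
        rw [← lintegral_const_mul' _ _ hC0T]
    _ ≤ _ := by
        rw [← hFN]
        gcongr
        exact hls p q hp1 hp2 hpq F hFm (by rw [hFN]; exact hN)
end

theorem weighted_bound (m : ℕ) (p : ℝ) (hp1 : 1 ≤ p) (hp2 : p < 2)
    (hp : p * ((m : ℝ) + 4) ≤ 2 * (m : ℝ) + 4) :
    ∃ K : ENNReal, K ≠ ⊤ ∧ ∀ f : EuclideanSpace ℝ (Fin m) × ℝ → ℂ, Measurable f → Integrable f →
      (∫⁻ z, ‖f z‖ₑ ^ p ≠ ⊤) →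
      ∫⁻ ξ : EuclideanSpace ℝ (Fin m), ENNReal.ofReal (rexp (-π * ‖ξ‖ ^ 2)) *
        ‖∫ z, f z * cexp (-2 * π * I * ((⟪z.1, ξ⟫ + z.2 * ‖ξ‖ ^ 2 : ℝ)))‖ₑ ^ 2 ≤
      K * (∫⁻ z, ‖f z‖ₑ ^ p) ^ (2 / p) := by
  rcases eq_or_lt_of_le hp1 with h | h
  · subst h
    refine ⟨1, by simp, fun f hfm hf hN => ?_⟩
    have hb : ∀ ξ : EuclideanSpace ℝ (Fin m),
        ‖∫ z, f z * cexp (-2 * π * I * ((⟪z.1, ξ⟫ + z.2 * ‖ξ‖ ^ 2 : ℝ)))‖ₑ ≤ ∫⁻ z, ‖f z‖ₑ := by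
      intro ξ
      refine (enorm_integral_le_lintegral_enorm _).trans (le_of_eq ?_)
      congr 1; ext z
      rw [enorm_mul]
      have := norm_phase (⟪z.1, ξ⟫ + z.2 * ‖ξ‖ ^ 2)
      rw [← ofReal_norm (cexp _), this]
      simp
    have hg := lint_gauss (V := EuclideanSpace ℝ (Fin m)) Real.pi_pos
    calc _ ≤ ∫⁻ ξ : EuclideanSpace ℝ (Fin m), ENNReal.ofReal (rexp (-π * ‖ξ‖ ^ 2)) *
          (∫⁻ z, ‖f z‖ₑ) ^ 2 := by
          refine lintegral_mono fun ξ => ?_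
          exact mul_le_mul_right (pow_le_pow_left' (hb ξ) 2) _
      _ = (∫⁻ ξ : EuclideanSpace ℝ (Fin m), ENNReal.ofReal (rexp (-π * ‖ξ‖ ^ 2))) *
          (∫⁻ z, ‖f z‖ₑ) ^ 2 := by
          rw [lintegral_mul_const]
          fun_prop
      _ = 1 * (∫⁻ z, ‖f z‖ₑ) ^ 2 := by
          congr 1
          rw [← hg]
          congr 1; ext ξ
          congr 1
          rw [div_self Real.pi_ne_zero, Real.one_rpow, one_mul]
          congr 1
          field_simp
      _ ≤ _ := by
          simp
  · have hpq := Real.HolderConjugate.conjExponent h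
    refine ⟨_, ?_, fun f hfm hf hN => (strichartz p _ h hp2 hpq (by simpa using hp) f hfm hf hN).trans
      (le_of_eq (mul_assoc _ _ _).symm)⟩
    refine ENNReal.mul_ne_top (ENNReal.rpow_ne_top_of_nonneg ?_ ENNReal.ofReal_ne_top)
      (ENNReal.mul_ne_top (by simp) ENNReal.ofReal_ne_top)
    have := hpq.symm.pos
    positivity

theorem stein_tomas_paraboloid (n : ℕ) (hn : 2 ≤ n) (p : ℝ) (hp1 : 1 ≤ p)
    (hp2 : p ≤ 2 * (n + 1) / (n + 3)) :
    ∃ C : ℝ, 0 < C ∧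
      ∀ f : SchwartzMap (EuclideanSpace ℝ (Fin (n - 1)) × ℝ) ℂ,
        (∫ ξ in {ξ : EuclideanSpace ℝ (Fin (n - 1)) | ∀ i, ξ i ∈ Set.Icc (-1 : ℝ) 1},
            ‖fourierParab (fun x => f x) (ξ, ∑ i, ξ i ^ 2)‖ ^ 2) ^ (1 / (2 : ℝ)) ≤
          C * (∫ x : EuclideanSpace ℝ (Fin (n - 1)) × ℝ, ‖f x‖ ^ p) ^ (1 / p) := by
  have hp0 : 0 < p := by linarith
  have hn' : (2 : ℝ) ≤ n := by exact_mod_cast hn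
  have hp3 : p * (n + 3) ≤ 2 * (n + 1) := by
    rwa [le_div_iff₀ (by positivity)] at hp2
  have hplt : p < 2 := by nlinarith
  have hcast : ((n - 1 : ℕ) : ℝ) = n - 1 := by
    rw [Nat.cast_sub (by omega)]; simp
  obtain ⟨K, hK, hb⟩ := weighted_bound (n - 1) p hp1 hplt (by rw [hcast]; nlinarith)
  generalize n - 1 = m at *
  set M : ℝ := rexp (π * m) * (K.toReal + 1) with hM
  have hMpos : 0 < M := by positivity
  refine ⟨M ^ (1 / (2 : ℝ)), by positivity, fun f => ?_⟩
  set N : ℝ := ∫ x : EuclideanSpace ℝ (Fin m) × ℝ, ‖f x‖ ^ p with hN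
  have hN0 : 0 ≤ N := integral_nonneg fun x => by positivity
  have hhaar : Measure.IsAddHaarMeasure (volume : Measure (EuclideanSpace ℝ (Fin m) × ℝ)) := by
    rw [Measure.volume_eq_prod]
    infer_instance
  have htg : Measure.HasTemperateGrowth (volume : Measure (EuclideanSpace ℝ (Fin m) × ℝ)) :=
    inferInstance
  have hmem : MemLp (fun x => f x) (ENNReal.ofReal p) volume := f.memLp _ _
  have hint : Integrable (fun x => ‖f x‖ ^ p) := by
    have := hmem.integrable_norm_rpow (by simpa using hp0) ENNReal.ofReal_ne_top
    rwa [ENNReal.toReal_ofReal hp0.le] at this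
  have hNe : ∫⁻ z, ‖f z‖ₑ ^ p = ENNReal.ofReal N := by
    rw [hN, ofReal_integral_eq_lintegral_ofReal hint (Filter.Eventually.of_forall fun x => by positivity)]
    congr 1; ext z
    rw [← ENNReal.ofReal_rpow_of_nonneg (norm_nonneg _) hp0.le, ofReal_norm]
  have hfm : Measurable (fun x => f x) := f.continuous.measurable
  have key := hb (fun x => f x) hfm f.integrable (by rw [hNe]; exact ENNReal.ofReal_ne_top)
  rw [hNe, ENNReal.ofReal_rpow_of_nonneg hN0 (by positivity)] at key
  set S : Set (EuclideanSpace ℝ (Fin m)) := {ξ | ∀ i, ξ i ∈ Set.Icc (-1 : ℝ) 1} with hS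
  have hSm : MeasurableSet S := by
    have : S = ⋂ i, (fun ξ : EuclideanSpace ℝ (Fin m) => ξ i) ⁻¹' Set.Icc (-1 : ℝ) 1 := by
      ext ξ; simp [hS]
    rw [this]
    refine MeasurableSet.iInter fun i => ?_
    exact measurableSet_Icc.preimage (by fun_prop)
  have hsq : ∀ ξ : EuclideanSpace ℝ (Fin m), ∑ i, ξ i ^ 2 = ‖ξ‖ ^ 2 := fun ξ => by
    rw [EuclideanSpace.real_norm_sq_eq]
  set P : EuclideanSpace ℝ (Fin m) → ℂ := fun ξ => fourierParab (fun x => f x) (ξ, ∑ i, ξ i ^ 2) with hP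
  have hPe : ∀ ξ, P ξ = ∫ z, f z * cexp (-2 * π * I * ((⟪z.1, ξ⟫ + z.2 * ‖ξ‖ ^ 2 : ℝ))) := by
    intro ξ
    simp only [hP, fourierParab, hsq]
  have hPm : StronglyMeasurable P := by
    have : StronglyMeasurable (Function.uncurry fun (ξ : EuclideanSpace ℝ (Fin m)) (z : EuclideanSpace ℝ (Fin m) × ℝ) => 
        f z * cexp (-2 * π * I * ((⟪z.1, ξ⟫ + z.2 * ‖ξ‖ ^ 2 : ℝ)))) := by
      apply Continuous.stronglyMeasurable
      have := f.continuous
      unfold Function.uncurry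
      fun_prop
    have h2 := this.integral_prod_right (ν := (volume : Measure (EuclideanSpace ℝ (Fin m) × ℝ)))
    have h3 : P = fun ξ => ∫ z, f z * cexp (-2 * π * I * ((⟪z.1, ξ⟫ + z.2 * ‖ξ‖ ^ 2 : ℝ))) := funext hPe
    rw [h3]; exact h2
  have hle : ∫⁻ ξ in S, ‖P ξ‖ₑ ^ 2 ≤ ENNReal.ofReal (M * N ^ (2 / p)) := by
    calc ∫⁻ ξ in S, ‖P ξ‖ₑ ^ 2 ≤ ∫⁻ ξ in S, ENNReal.ofReal (rexp (π * m)) *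
          (ENNReal.ofReal (rexp (-π * ‖ξ‖ ^ 2)) * ‖P ξ‖ₑ ^ 2) := by
          refine setLIntegral_mono' hSm fun ξ hξ => ?_
          rw [← mul_assoc, ← ENNReal.ofReal_mul (by positivity), ← Real.exp_add]
          refine le_mul_of_one_le_left (by positivity) ?_
          rw [ENNReal.one_le_ofReal]
          refine Real.one_le_exp ?_
          have : ‖ξ‖ ^ 2 ≤ m := by
            rw [← hsq]
            calc ∑ i, ξ i ^ 2 ≤ ∑ i : Fin m, (1 : ℝ) := by
                  refine Finset.sum_le_sum fun i _ => ?_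
                  have := hξ i
                  rw [sq_le_one_iff_abs_le_one, abs_le]
                  exact this
              _ = m := by simp
          nlinarith [Real.pi_pos]
      _ ≤ ∫⁻ ξ, ENNReal.ofReal (rexp (π * m)) *
          (ENNReal.ofReal (rexp (-π * ‖ξ‖ ^ 2)) * ‖P ξ‖ₑ ^ 2) := setLIntegral_le_lintegral _ _
      _ = ENNReal.ofReal (rexp (π * m)) *
          ∫⁻ ξ, (ENNReal.ofReal (rexp (-π * ‖ξ‖ ^ 2)) * ‖P ξ‖ₑ ^ 2) := by
          rw [lintegral_const_mul' _ _ ENNReal.ofReal_ne_top]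
      _ ≤ ENNReal.ofReal (rexp (π * m)) * (K * ENNReal.ofReal (N ^ (2 / p))) := by
          refine mul_le_mul_right ?_ _
          simp_rw [hPe]
          exact key
      _ ≤ ENNReal.ofReal (rexp (π * m)) * (ENNReal.ofReal (K.toReal + 1) * ENNReal.ofReal (N ^ (2 / p))) := by
          refine mul_le_mul_right (mul_le_mul_left ?_ _) _
          rw [← ENNReal.ofReal_toReal hK]
          apply ENNReal.ofReal_le_ofReal
          simp
      _ = _ := by
          rw [← ENNReal.ofReal_mul (by positivity), ← ENNReal.ofReal_mul (by positivity), hM, mul_assoc]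
  have hfin : ∫ ξ in S, ‖P ξ‖ ^ 2 ≤ M * N ^ (2 / p) := by
    rw [integral_eq_lintegral_of_nonneg_ae (Filter.Eventually.of_forall fun x => by positivity)
      (by exact ((hPm.norm.pow 2).aestronglyMeasurable))]
    refine ENNReal.toReal_le_of_le_ofReal (by positivity) ?_
    refine le_trans (le_of_eq ?_) hle
    congr 1; ext ξ
    rw [ENNReal.ofReal_pow (norm_nonneg _), ofReal_norm]
  calc (∫ ξ in S, ‖P ξ‖ ^ 2) ^ (1 / (2 : ℝ)) ≤ (M * N ^ (2 / p)) ^ (1 / (2 : ℝ)) := by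
        refine Real.rpow_le_rpow (integral_nonneg fun x => by positivity) hfin (by norm_num)
    _ = M ^ (1 / (2 : ℝ)) * N ^ (1 / p) := by
        rw [Real.mul_rpow hMpos.le (by positivity), ← Real.rpow_mul hN0]
        congr 2
        field_simp
end

section
/- (Reverse square function inequality.) There is an absolute constant C such that the following holds for all sufficiently small δ > 0. Let J_1, J_2 ⊆ [−1,1] be intervals, and for j = 1, 2 let 𝒫_j be a partition of J_j into finitely many intervals of length δ. For each interval I ∈ 𝒫_1 ∪ 𝒫_2 let f_I ∈ L¹(ℝ²) be a function whose Fourier transform f̂_I is supported in the parabolic cap N_I(δ²), and set f_{J_j} := ∑_{I ∈ 𝒫_j} f_I. Then ‖|f_{J_1} f_{J_2}|^{1/2}‖_{L⁴(ℝ²)} ≤ C ‖(∑_{I_1 ∈ 𝒫_1} |f_{I_1}|²)^{1/4} (∑_{I_2 ∈ 𝒫_2} |f_{I_2}|²)^{1/4}‖_{L⁴(ℝ²)}. -/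
open MeasureTheory Real Complex ENNReal

/-- The parabolic cap `N_I(σ) = {(ξ, ξ² + t) : ξ ∈ I, |t| ≤ σ} ⊆ ℝ²`. -/
def parabolicCap (I : Set ℝ) (σ : ℝ) : Set (ℝ × ℝ) :=
  {p | ∃ ξ ∈ I, ∃ t : ℝ, |t| ≤ σ ∧ p = (ξ, ξ ^ 2 + t)}

/-- The Fourier transform `f̂(ξ) = ∫_{ℝ²} f(x) e^{−2πi x·ξ} dx` on `ℝ² = ℝ × ℝ`. -/
noncomputable def fourier2 (f : ℝ × ℝ → ℂ) (ξ : ℝ × ℝ) : ℂ :=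
  ∫ x : ℝ × ℝ, f x * Complex.exp (-2 * Real.pi * Complex.I * ((x.1 * ξ.1 + x.2 * ξ.2 : ℝ)))

open scoped FourierTransform ContDiff in
lemma fourier_inv_ae {V : Type*} [NormedAddCommGroup V] [InnerProductSpace ℝ V]
    [MeasurableSpace V] [BorelSpace V] [FiniteDimensional ℝ V] (f : V → ℂ)
    (hf : Integrable f) (hf' : Integrable (𝓕 f)) : ∀ᵐ x, f x = 𝓕⁻ (𝓕 f) x := by
  have hsa : ∀ a b : V → ℂ, Integrable a → Integrable b → ∫ x, 𝓕 a x * b x = ∫ x, a x * 𝓕 b x := by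
    intro a b ha hb
    simpa using! (VectorFourier.integral_fourierIntegral_smul_eq_flip (L := innerₗ V)
      Real.continuous_fourierChar continuous_inner ha hb)
  have hc : Continuous (𝓕⁻ (𝓕 f)) := by
    have h1 : Continuous (𝓕 (𝓕 f)) :=
      (VectorFourier.fourierIntegral_continuous Real.continuous_fourierChar
        (innerSL ℝ).continuous₂ hf')
    have : 𝓕⁻ (𝓕 f) = fun x => 𝓕 (𝓕 f) (-x) := by
      ext x; rw [Real.fourierInv_eq_fourier_neg]
    rw [this]
    exact h1.comp continuous_neg
  refine ae_eq_of_integral_contDiff_smul_eq hf.locallyIntegrable hc.locallyIntegrable ?_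
  intro g hg hgc
  have hgC : HasCompactSupport (fun x => (g x : ℂ)) := hgc.comp_left (g := fun r : ℝ => (r:ℂ)) (by simp)
  have hgd : ContDiff ℝ ∞ (fun x => (g x : ℂ)) := Complex.ofRealCLM.contDiff.comp hg
  let φ : SchwartzMap V ℂ := hgC.toSchwartzMap hgd
  have hφ : ∀ x, φ x = (g x : ℂ) := fun x => rfl
  have e1 : ∀ x, (g x : ℂ) = 𝓕 (𝓕⁻ (φ : V → ℂ)) x := by
    intro x
    rw [← hφ, ← SchwartzMap.fourierInv_coe, ← SchwartzMap.fourier_coe]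
    simp
  have i1 : Integrable (𝓕⁻ (φ : V → ℂ)) := by
    rw [← SchwartzMap.fourierInv_coe]; exact SchwartzMap.integrable _
  have i2 : Integrable (fun x => φ (-x)) := φ.integrable.comp_neg
  calc ∫ x, g x • f x = ∫ x, 𝓕 (𝓕⁻ (φ : V → ℂ)) x * f x := by
        congr 1; ext x; rw [← e1]; simp
    _ = ∫ x, 𝓕⁻ (φ : V → ℂ) x * 𝓕 f x := hsa _ _ i1 hf
    _ = ∫ x, 𝓕 (fun x => φ (-x)) x * 𝓕 f x := by rw [Real.fourierInv_eq_fourier_comp_neg]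
    _ = ∫ x, φ (-x) * 𝓕 (𝓕 f) x := hsa _ _ i2 hf'
    _ = ∫ x, φ x * 𝓕 (𝓕 f) (-x) := by
        rw [← integral_neg_eq_self]; simp
    _ = ∫ x, g x • 𝓕⁻ (𝓕 f) x := by
        congr 1; ext x; rw [Real.fourierInv_eq_fourier_neg, hφ]; simp

/-- the dot product on the plane -/
noncomputable def dot2 : (ℝ × ℝ) →ₗ[ℝ] (ℝ × ℝ) →ₗ[ℝ] ℝ :=
  LinearMap.mk₂ ℝ (fun x y => x.1 * y.1 + x.2 * y.2)
    (by intros; simp; ring) (by intros; simp; ring) (by intros; simp; ring) (by intros; simp; ring)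

lemma dot2_cont : Continuous fun p : (ℝ × ℝ) × (ℝ × ℝ) => dot2 p.1 p.2 := by
  simp only [dot2, LinearMap.mk₂_apply]; fun_prop

lemma fourier2_eq_vf (f : ℝ × ℝ → ℂ) :
    fourier2 f = VectorFourier.fourierIntegral Real.fourierChar volume dot2 f := by
  ext ξ
  rw [Real.vector_fourierIntegral_eq_integral_exp_smul]
  unfold fourier2
  congr 1; ext x
  rw [smul_eq_mul, mul_comm]
  congr 2
  simp [dot2]; ring

lemma dot2_flip : dot2.flip = dot2 := by
  ext <;> simp [dot2]

lemma fourier2_continuous {f : ℝ × ℝ → ℂ} (hf : Integrable f) : Continuous (fourier2 f) := by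
  rw [fourier2_eq_vf]
  exact VectorFourier.fourierIntegral_continuous Real.continuous_fourierChar dot2_cont hf

lemma fourier2_bound (f : ℝ × ℝ → ℂ) (ξ) : ‖fourier2 f ξ‖ ≤ ∫ x, ‖f x‖ := by
  rw [fourier2_eq_vf]
  exact VectorFourier.norm_fourierIntegral_le_integral_norm _ _ _ _ _

lemma fourier2_sa {a b : ℝ × ℝ → ℂ} (ha : Integrable a) (hb : Integrable b) :
    ∫ x, fourier2 a x * b x = ∫ x, a x * fourier2 b x := by
  have := VectorFourier.integral_fourierIntegral_smul_eq_flip (L := dot2)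
      Real.continuous_fourierChar dot2_cont ha hb
  rw [dot2_flip, ← fourier2_eq_vf, ← fourier2_eq_vf] at this
  simpa using this

open scoped FourierTransform in
lemma fourier2_inv {f : ℝ × ℝ → ℂ} (hf : Integrable f) (hf' : Integrable (fourier2 f)) :
    ∀ᵐ x, f x = fourier2 (fourier2 f) (-x) := by
  have hp := WithLp.volume_preserving_ofLp ℝ ℝ
  have hq := WithLp.volume_preserving_toLp ℝ ℝ
  have emb : MeasurableEmbedding (WithLp.toLp 2 : ℝ × ℝ → WithLp 2 (ℝ × ℝ)) :=
    (MeasurableEquiv.toLp 2 (ℝ × ℝ)).measurableEmbedding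
  have key : ∀ g : ℝ × ℝ → ℂ, 𝓕 (fun v : WithLp 2 (ℝ × ℝ) => g v.ofLp)
      = fun v => fourier2 g v.ofLp := by
    intro g; ext v
    rw [Real.fourier_eq', ← hq.integral_comp emb]
    unfold fourier2
    congr 1; ext x
    rw [smul_eq_mul, mul_comm]
    congr 2
    simp [WithLp.prod_inner_apply]; ring
  have hF : Integrable (fun v : WithLp 2 (ℝ × ℝ) => f v.ofLp) := hp.integrable_comp_of_integrable hf
  have := fourier_inv_ae (fun v : WithLp 2 (ℝ × ℝ) => f v.ofLp) hF (by
    rw [key]; exact hp.integrable_comp_of_integrable hf')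
  rw [key] at this
  have h2 := hq.quasiMeasurePreserving.ae this
  filter_upwards [h2] with x hx
  rw [Real.fourierInv_eq_fourier_neg, key] at hx
  simpa using hx

lemma fourier2_mul {f g : ℝ × ℝ → ℂ} (hf : Integrable f) (hf' : Integrable (fourier2 f))
    (hg : Integrable g) (η : ℝ × ℝ) :
    fourier2 (fun x => f x * g x) η = ∫ ξ, fourier2 f ξ * fourier2 g (η - ξ) := by
  set e : ℝ × ℝ → ℂ := fun x =>
    Complex.exp (-2 * Real.pi * Complex.I * ((x.1 * η.1 + x.2 * η.2 : ℝ))) with he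
  have hen : ∀ x, ‖e x‖ = 1 := by
    intro x
    simp [he, Complex.norm_exp]
  have hec : Continuous e := by fun_prop
  have hi : Integrable (fun x => g (-x) * e (-x)) := by
    have : Integrable (fun x => g x * e x) := by
      refine hg.mul_bdd (c := 1) hec.aestronglyMeasurable (by simp [hen])
    exact this.comp_neg
  calc fourier2 (fun x => f x * g x) η = ∫ x, f x * (g x * e x) := by
        unfold fourier2; simp only [he, mul_assoc]
    _ = ∫ x, fourier2 (fourier2 f) (-x) * (g x * e x) := by
        refine integral_congr_ae ?_
        filter_upwards [fourier2_inv hf hf'] with x hx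
        rw [← hx]
    _ = ∫ x, fourier2 (fourier2 f) x * (g (-x) * e (-x)) := by
        rw [← integral_neg_eq_self]; simp
    _ = ∫ ξ, fourier2 f ξ * fourier2 (fun x => g (-x) * e (-x)) ξ := fourier2_sa hf' hi
    _ = _ := by
        congr 1; ext ξ; congr 1
        unfold fourier2
        rw [← integral_neg_eq_self]
        congr 1; ext x
        simp only [neg_neg, mul_assoc, he, ← Complex.exp_add]
        congr 2
        simp; ring

lemma fourier2_memLp_bdd {f : ℝ × ℝ → ℂ} (hf : Integrable f) (hf' : Integrable (fourier2 f)) :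
    ∀ᵐ x, ‖f x‖ ≤ ∫ ξ, ‖fourier2 f ξ‖ := by
  filter_upwards [fourier2_inv hf hf'] with x hx
  rw [hx]; exact fourier2_bound _ _

lemma mul_int {f g : ℝ × ℝ → ℂ} (hf : Integrable f) (hf' : Integrable (fourier2 f))
    (hg : Integrable g) : Integrable (fun x => f x * g x) :=
  hg.bdd_mul hf.aestronglyMeasurable (fourier2_memLp_bdd hf hf')

open ComplexConjugate in
lemma fourier2_plancherel {f : ℝ × ℝ → ℂ} (hf : Integrable f) (hf' : Integrable (fourier2 f)) :
    ∫⁻ x, (‖f x‖₊ : ℝ≥0∞) ^ 2 = ∫⁻ x, (‖fourier2 f x‖₊ : ℝ≥0∞) ^ 2 := by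
  have hgi : Integrable (fun x => conj (f x)) := by
    simpa using! Complex.conjCLE.toContinuousLinearMap.integrable_comp hf
  have h1 := fourier2_mul hf hf' hgi 0
  have hconj : ∀ ξ, fourier2 (fun x => conj (f x)) (0 - ξ) = conj (fourier2 f ξ) := by
    intro ξ
    unfold fourier2
    rw [← integral_conj]
    congr 1; ext x
    rw [map_mul, ← Complex.exp_conj]
    congr 2
    have c2 : (starRingEnd ℂ) 2 = 2 := map_ofNat _ 2
    simp [c2]; ring
  simp only [hconj] at h1
  have h2 : fourier2 (fun x => f x * conj (f x)) 0 = ∫ x, f x * conj (f x) := by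
    simp [fourier2]
  rw [h2] at h1
  simp only [Complex.mul_conj] at h1
  rw [integral_complex_ofReal, integral_complex_ofReal] at h1
  have h3 := Complex.ofReal_injective h1
  have conv : ∀ u : ℝ × ℝ → ℂ, (fun x => (‖u x‖₊ : ℝ≥0∞) ^ 2) = fun x => ENNReal.ofReal (Complex.normSq (u x)) := by
    intro u; ext x
    rw [Complex.normSq_eq_norm_sq, ENNReal.ofReal_pow (norm_nonneg _), ofReal_norm_eq_enorm]; rfl
  have i1 : Integrable (fun x => Complex.normSq (f x)) := by
    have := (mul_int hf hf' hgi).re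
    simpa [Complex.mul_conj] using! this
  have i2 : Integrable (fun x => Complex.normSq (fourier2 f x)) := by
    have : Integrable (fun x => fourier2 f x * conj (fourier2 f x)) := by
      refine hf'.mul_bdd (c := ∫ x, ‖f x‖) ?_ ?_
      · exact (Complex.continuous_conj.comp (fourier2_continuous hf)).aestronglyMeasurable
      · filter_upwards with x
        simpa using fourier2_bound f x
    simpa [Complex.mul_conj] using! this.re
  rw [conv, conv, ← ofReal_integral_eq_lintegral_ofReal i1 (by filter_upwards with x; exact Complex.normSq_nonneg _),
    ← ofReal_integral_eq_lintegral_ofReal i2 (by filter_upwards with x; exact Complex.normSq_nonneg _), h3]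

lemma cap_compact (a b σ : ℝ) : IsCompact (parabolicCap (Set.Icc a b) σ) := by
  have : parabolicCap (Set.Icc a b) σ =
      (fun p : ℝ × ℝ => (p.1, p.1 ^ 2 + p.2)) '' (Set.Icc a b ×ˢ Set.Icc (-σ) σ) := by
    ext p
    constructor
    · rintro ⟨ξ, hξ, t, ht, rfl⟩
      exact ⟨(ξ, t), ⟨hξ, abs_le.1 ht⟩, rfl⟩
    · rintro ⟨⟨ξ, t⟩, ⟨hξ, ht⟩, rfl⟩
      exact ⟨ξ, hξ, t, abs_le.2 ht, rfl⟩
  rw [this]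
  exact (isCompact_Icc.prod isCompact_Icc).image (by fun_prop)

lemma fourier2_int {f : ℝ × ℝ → ℂ} (hf : Integrable f) {K : Set (ℝ × ℝ)} (hK : IsCompact K)
    (h : Function.support (fourier2 f) ⊆ K) : Integrable (fourier2 f) :=
  (fourier2_continuous hf).integrable_of_hasCompactSupport
    (HasCompactSupport.of_support_subset_isCompact hK h)

lemma fourier2_mul_support {f g : ℝ × ℝ → ℂ} (hf : Integrable f) (hf' : Integrable (fourier2 f))
    (hg : Integrable g) {K L : Set (ℝ × ℝ)} (hK : Function.support (fourier2 f) ⊆ K)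
    (hL : Function.support (fourier2 g) ⊆ L) (η : ℝ × ℝ)
    (h : fourier2 (fun x => f x * g x) η ≠ 0) : ∃ ξ ∈ K, ∃ ζ ∈ L, ξ + ζ = η := by
  by_contra! hc
  apply h
  rw [fourier2_mul hf hf' hg]
  have : ∀ ξ, fourier2 f ξ * fourier2 g (η - ξ) = 0 := by
    intro ξ
    by_contra h0
    rw [mul_eq_zero, not_or] at h0
    exact hc ξ (hK h0.1) (η - ξ) (hL h0.2) (by simp)
  simp [this]

lemma fourier2_sum {ι : Type*} [Fintype ι] {g : ι → ℝ × ℝ → ℂ} (hg : ∀ p, Integrable (g p)) (η) :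
    fourier2 (fun x => ∑ p, g p x) η = ∑ p, fourier2 (g p) η := by
  unfold fourier2
  simp only [Finset.sum_mul]
  rw [integral_finsetSum]
  intro p _
  refine (hg p).mul_bdd (c := 1) (Continuous.aestronglyMeasurable (by fun_prop)) ?_
  filter_upwards with x
  simp [Complex.norm_exp]

lemma almost_orth {ι : Type*} [Fintype ι] {g : ι → ℝ × ℝ → ℂ} (hg : ∀ p, Integrable (g p))
    (hg' : ∀ p, Integrable (fourier2 (g p))) (M : ℕ)
    (hM : ∀ η, ∀ s : Finset ι, (∀ p ∈ s, fourier2 (g p) η ≠ 0) → s.card ≤ M) :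
    ∫⁻ x, (‖∑ p, g p x‖₊ : ℝ≥0∞) ^ 2 ≤ M * ∑ p, ∫⁻ x, (‖g p x‖₊ : ℝ≥0∞) ^ 2 := by
  classical
  have hG : Integrable (fun x => ∑ p, g p x) := integrable_finsetSum _ fun p _ => hg p
  have hG' : Integrable (fourier2 fun x => ∑ p, g p x) := by
    rw [funext (fourier2_sum hg)]; exact integrable_finsetSum _ fun p _ => hg' p
  rw [fourier2_plancherel hG hG']
  simp only [fun p => fourier2_plancherel (hg p) (hg' p)]
  rw [← lintegral_finsetSum', ← lintegral_const_mul']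
  · refine lintegral_mono fun η => ?_
    rw [fourier2_sum hg]
    norm_cast
    set s := Finset.univ.filter fun p => fourier2 (g p) η ≠ 0 with hs
    have hsc : s.card ≤ M := hM η s (by simp [hs])
    have e1 : ∑ p, fourier2 (g p) η = ∑ p ∈ s, fourier2 (g p) η := (Finset.sum_filter_ne_zero _).symm
    rw [e1]
    refine ENNReal.coe_le_coe.2 ?_
    calc ‖∑ p ∈ s, fourier2 (g p) η‖₊ ^ 2 ≤ (∑ p ∈ s, ‖fourier2 (g p) η‖₊) ^ 2 := by
          gcongr; exact nnnorm_sum_le _ _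
      _ ≤ s.card * ∑ p ∈ s, ‖fourier2 (g p) η‖₊ ^ 2 := sq_sum_le_card_mul_sum_sq
      _ ≤ M * ∑ p, ‖fourier2 (g p) η‖₊ ^ 2 := by
          gcongr
          exact Finset.subset_univ _
  · exact ENNReal.natCast_ne_top M
  · intro p _
    have := (fourier2_continuous (hg p)).nnnorm.measurable
    exact (this.coe_nnreal_ennreal.pow_const 2).aemeasurable

/-- few intervals of length `δ` are close to a given point -/
lemma card_near (m : ℕ) (b δ c : ℝ) (hδ : 0 < δ) :
    (Finset.univ.filter fun k : Fin m => |b + k * δ - c| ≤ 5 / 2 * δ).card ≤ 7 := by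
  have : (Finset.Icc (-3 : ℤ) 3).card = 7 := by decide
  rw [← this]
  refine Finset.card_le_card_of_injOn (fun k : Fin m => (k : ℤ) - ⌊(c - b) / δ⌋) ?_ ?_
  · intro k hk
    simp only [Finset.coe_filter, Finset.mem_univ, true_and, Set.mem_setOf_eq] at hk
    obtain ⟨h1, h2⟩ := abs_le.1 hk
    have f1 := Int.floor_le ((c - b) / δ)
    have f2 := Int.lt_floor_add_one ((c - b) / δ)
    have g1 : (k : ℝ) - (c - b) / δ ≤ 5 / 2 := by
      rw [sub_le_iff_le_add, ← mul_le_mul_iff_left₀ hδ, add_mul, div_mul_cancel₀ _ hδ.ne']; linarith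
    have g2 : (c - b) / δ - k ≤ 5 / 2 := by
      rw [sub_le_iff_le_add, ← mul_le_mul_iff_left₀ hδ, add_mul, div_mul_cancel₀ _ hδ.ne']; linarith
    rw [Finset.mem_coe, Finset.mem_Icc]
    have k1 : (((k : ℤ) - ⌊(c - b) / δ⌋ : ℤ) : ℝ) < 4 := by push_cast; linarith
    have k2 : (-4 : ℝ) < (((k : ℤ) - ⌊(c - b) / δ⌋ : ℤ) : ℝ) := by push_cast; linarith
    have k1' : (k : ℤ) - ⌊(c - b) / δ⌋ < 4 := by exact_mod_cast k1
    have k2' : -4 < (k : ℤ) - ⌊(c - b) / δ⌋ := by exact_mod_cast k2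
    exact ⟨by show -3 ≤ (k : ℤ) - ⌊(c - b) / δ⌋; omega, by show (k : ℤ) - ⌊(c - b) / δ⌋ ≤ 3; omega⟩
  · intro k _ l _ h
    simp only [sub_left_inj, Nat.cast_inj] at h
    exact Fin.ext h

lemma near_of (δ s q x1 x2 z1 z2 t1 t2 u1 u2 : ℝ) (hδ : 0 < δ)
    (ht1 : |t1| ≤ δ ^ 2) (ht2 : |t2| ≤ δ ^ 2) (hu1 : |u1| ≤ δ ^ 2) (hu2 : |u2| ≤ δ ^ 2)
    (hs : x1 + x2 = s) (hs' : z1 + z2 = s)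
    (hq : x1 ^ 2 + t1 + (x2 ^ 2 + t2) = q) (hq' : z1 ^ 2 + u1 + (z2 ^ 2 + u2) = q) :
    (|x1 - z1| ≤ 3 / 2 * δ ∧ |x2 - z2| ≤ 3 / 2 * δ) ∨
    (|x1 - z2| ≤ 3 / 2 * δ ∧ |x2 - z1| ≤ 3 / 2 * δ) := by
  have e2 : x2 - z2 = -(x1 - z1) := by linarith
  have e1 : x2 - z1 = -(x1 - z2) := by linarith
  rw [e1, e2, abs_neg, abs_neg, and_self, and_self]
  by_contra! h
  obtain ⟨h1, h2⟩ := h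
  have hp : (x1 - z1) * (x1 - z2) = (u1 + u2 - t1 - t2) / 2 := by
    have a : x2 = s - x1 := by linarith
    have b : z2 = s - z1 := by linarith
    subst a b
    linear_combination (hq - hq') / 2
  have h3 : |(x1 - z1) * (x1 - z2)| ≤ 2 * δ ^ 2 := by
    rw [hp]
    rw [abs_le] at *
    constructor <;> linarith
  rw [abs_mul] at h3
  nlinarith [mul_lt_mul'' h1 h2 (by positivity) (by positivity)]

lemma card_overlap (δ : ℝ) (hδ : 0 < δ) (m₁ m₂ : ℕ) (b₁ b₂ : ℝ) (η : ℝ × ℝ)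
    (s : Finset (Fin m₁ × Fin m₂))
    (hs : ∀ p ∈ s, ∃ ξ ∈ parabolicCap (Set.Icc (b₁ + p.1 * δ) (b₁ + (p.1 + 1) * δ)) (δ ^ 2),
      ∃ ζ ∈ parabolicCap (Set.Icc (b₂ + p.2 * δ) (b₂ + (p.2 + 1) * δ)) (δ ^ 2), ξ + ζ = η) :
    s.card ≤ 98 := by
  classical
  rcases s.eq_empty_or_nonempty with rfl | ⟨p0, hp0⟩
  · simp
  obtain ⟨_, ⟨z1, hz1, u1, hu1, rfl⟩, _, ⟨z2, hz2, u2, hu2, rfl⟩, h0⟩ := hs p0 hp0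
  let A (m : ℕ) (b c : ℝ) := Finset.univ.filter fun k : Fin m => |b + k * δ - c| ≤ 5 / 2 * δ
  have hsub : s ⊆ (A m₁ b₁ z1 ×ˢ A m₂ b₂ z2) ∪ (A m₁ b₁ z2 ×ˢ A m₂ b₂ z1) := by
    intro p hp
    obtain ⟨_, ⟨x1, hx1, t1, ht1, rfl⟩, _, ⟨x2, hx2, t2, ht2, rfl⟩, h1⟩ := hs p hp
    have hn := near_of δ η.1 η.2 x1 x2 z1 z2 t1 t2 u1 u2 hδ ht1 ht2 hu1 hu2
      (congrArg Prod.fst h1) (congrArg Prod.fst h0) (congrArg Prod.snd h1) (congrArg Prod.snd h0)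
    have near : ∀ (b k x z : ℝ), x ∈ Set.Icc (b + k * δ) (b + (k + 1) * δ) → |x - z| ≤ 3 / 2 * δ →
        |b + k * δ - z| ≤ 5 / 2 * δ := by
      intro b k x z hx hxz
      rw [abs_le] at *
      obtain ⟨a1, a2⟩ := hx
      constructor <;> linarith [hxz.1, hxz.2]
    simp only [A, Finset.mem_union, Finset.mem_product, Finset.mem_filter, Finset.mem_univ, true_and]
    rcases hn with ⟨n1, n2⟩ | ⟨n1, n2⟩
    · exact Or.inl ⟨near _ _ _ _ hx1 n1, near _ _ _ _ hx2 n2⟩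
    · exact Or.inr ⟨near _ _ _ _ hx1 n1, near _ _ _ _ hx2 n2⟩
  calc s.card ≤ _ := Finset.card_le_card hsub
    _ ≤ _ := Finset.card_union_le _ _
    _ ≤ 7 * 7 + 7 * 7 := by
        rw [Finset.card_product, Finset.card_product]
        gcongr <;> exact card_near _ _ _ _ hδ
    _ = 98 := by norm_num

/-- **Reverse square function inequality.** There is an absolute constant `C` such that for
all sufficiently small `δ > 0`, all intervals `J_j = [b_j, b_j + m_j δ] ⊆ [−1,1]` partitioned
into the `m_j` consecutive intervals `I_{j,k} = [b_j + kδ, b_j + (k+1)δ]` of length `δ`, and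
all integrable `f_{j,k}` with `f̂_{j,k}` supported in `N_{I_{j,k}}(δ²)`, setting
`f_{J_j} := ∑_k f_{j,k}`, one has
`‖|f_{J₁} f_{J₂}|^{1/2}‖_{L⁴(ℝ²)} ≤ C ‖(∑_k |f_{1,k}|²)^{1/4} (∑_k |f_{2,k}|²)^{1/4}‖_{L⁴(ℝ²)}`
(both fourth powers written out). -/
theorem reverse_square_function_inequality :
    ∃ C : ℝ, 0 < C ∧ ∃ δ₀ : ℝ, 0 < δ₀ ∧
      ∀ δ : ℝ, 0 < δ → δ < δ₀ →
      ∀ (m₁ m₂ : ℕ) (b₁ b₂ : ℝ),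
        Set.Icc b₁ (b₁ + m₁ * δ) ⊆ Set.Icc (-1 : ℝ) 1 →
        Set.Icc b₂ (b₂ + m₂ * δ) ⊆ Set.Icc (-1 : ℝ) 1 →
      ∀ (f₁ : Fin m₁ → ℝ × ℝ → ℂ) (f₂ : Fin m₂ → ℝ × ℝ → ℂ),
        (∀ k, Integrable (f₁ k)) → (∀ k, Integrable (f₂ k)) →
        (∀ k : Fin m₁, Function.support (fourier2 (f₁ k)) ⊆
          parabolicCap (Set.Icc (b₁ + k * δ) (b₁ + (k + 1) * δ)) (δ ^ 2)) →
        (∀ k : Fin m₂, Function.support (fourier2 (f₂ k)) ⊆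
          parabolicCap (Set.Icc (b₂ + k * δ) (b₂ + (k + 1) * δ)) (δ ^ 2)) →
        (∫⁻ x : ℝ × ℝ,
            (‖∑ k, f₁ k x‖₊ : ℝ≥0∞) ^ 2 * (‖∑ k, f₂ k x‖₊ : ℝ≥0∞) ^ 2) ^ (1 / (4 : ℝ)) ≤
          ENNReal.ofReal C *
            (∫⁻ x : ℝ × ℝ,
              (∑ k, (‖f₁ k x‖₊ : ℝ≥0∞) ^ 2) * (∑ k, (‖f₂ k x‖₊ : ℝ≥0∞) ^ 2)) ^ (1 / (4 : ℝ)) := by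
  refine ⟨4, by norm_num, 1, one_pos, ?_⟩
  intro δ hδ _ m₁ m₂ b₁ b₂ _ _ f₁ f₂ hf₁ hf₂ hs₁ hs₂
  have i₁ : ∀ k, Integrable (fourier2 (f₁ k)) := fun k =>
    fourier2_int (hf₁ k) (cap_compact _ _ _) (hs₁ k)
  let g : Fin m₁ × Fin m₂ → ℝ × ℝ → ℂ := fun p x => f₁ p.1 x * f₂ p.2 x
  have hg : ∀ p, Integrable (g p) := fun p => mul_int (hf₁ p.1) (i₁ p.1) (hf₂ p.2)
  have hsupp : ∀ p η, fourier2 (g p) η ≠ 0 →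
      ∃ ξ ∈ parabolicCap (Set.Icc (b₁ + p.1 * δ) (b₁ + (p.1 + 1) * δ)) (δ ^ 2),
      ∃ ζ ∈ parabolicCap (Set.Icc (b₂ + p.2 * δ) (b₂ + (p.2 + 1) * δ)) (δ ^ 2), ξ + ζ = η :=
    fun p η h => fourier2_mul_support (hf₁ p.1) (i₁ p.1) (hf₂ p.2) (hs₁ p.1) (hs₂ p.2) η h
  have hg' : ∀ p, Integrable (fourier2 (g p)) := by
    intro p
    refine fourier2_int (hg p) ((cap_compact (b₁ + p.1 * δ) (b₁ + (p.1 + 1) * δ) (δ ^ 2)).prod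
      (cap_compact (b₂ + p.2 * δ) (b₂ + (p.2 + 1) * δ) (δ ^ 2)) |>.image continuous_add) ?_
    intro η hη
    obtain ⟨ξ, hξ, ζ, hζ, h⟩ := hsupp p η hη
    exact ⟨(ξ, ζ), ⟨hξ, hζ⟩, h⟩
  have key := almost_orth hg hg' 98 (fun η s h =>
    card_overlap δ hδ m₁ m₂ b₁ b₂ η s (fun p hp => hsupp p η (h p hp)))
  have eL : ∀ x, (‖∑ k, f₁ k x‖₊ : ℝ≥0∞) ^ 2 * (‖∑ k, f₂ k x‖₊ : ℝ≥0∞) ^ 2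
      = (‖∑ p, g p x‖₊ : ℝ≥0∞) ^ 2 := by
    intro x
    have : ∑ p, g p x = (∑ k, f₁ k x) * ∑ k, f₂ k x := by
      rw [Finset.sum_mul_sum, Fintype.sum_prod_type]
    rw [this, nnnorm_mul, ENNReal.coe_mul, mul_pow]
  have eR : ∀ x, (∑ k, (‖f₁ k x‖₊ : ℝ≥0∞) ^ 2) * (∑ k, (‖f₂ k x‖₊ : ℝ≥0∞) ^ 2)
      = ∑ p, (‖g p x‖₊ : ℝ≥0∞) ^ 2 := by
    intro x
    rw [Finset.sum_mul_sum, Fintype.sum_prod_type]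
    simp only [g, nnnorm_mul, ENNReal.coe_mul, mul_pow]
  simp only [eL, eR]
  have hsum : ∫⁻ x, ∑ p, (‖g p x‖₊ : ℝ≥0∞) ^ 2 = ∑ p, ∫⁻ x, (‖g p x‖₊ : ℝ≥0∞) ^ 2 :=
    lintegral_finsetSum' _ fun p _ => (hg p).aestronglyMeasurable.enorm.pow_const 2
  rw [hsum]
  set R := ∑ p, ∫⁻ x, (‖g p x‖₊ : ℝ≥0∞) ^ 2 with hR
  have h4 : (ENNReal.ofReal 4) = (256 : ℝ≥0∞) ^ (1 / (4 : ℝ)) := by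
    have : (256 : ℝ≥0∞) = (4 : ℝ≥0∞) ^ (4 : ℝ) := by
      rw [show (4 : ℝ) = ((4 : ℕ) : ℝ) by norm_num, ENNReal.rpow_natCast]; norm_num
    rw [this, ← ENNReal.rpow_mul]; norm_num
  rw [h4]
  change _ ≤ _ * R ^ (1 / (4 : ℝ))
  rw [← ENNReal.mul_rpow_of_nonneg _ _ (by norm_num)]
  refine ENNReal.rpow_le_rpow (key.trans ?_) (by norm_num)
  gcongr
  norm_num
end
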